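/- arXiv:2102.09994 — 10 statements merged into one kernel-verified Lean document; each statement's English description precedes it below -/
import Mathlib

section
/- Let Q ⊆ ℝⁿ be a simplex (the convex hull of affinely independent points, not necessarily full-dimensional) and let a·x ≤ b be a facet-defining inequality for Q, defining the facet S (which is itself a simplex). Suppose W_a := w(a, Q) > 0. For b' ∈ [b − W_a, b], consider the slice S' := Q ∩ {x ∈ ℝⁿ : a·x = b'}. Then S' is a translate of the scaled set ((W_a − (b − b'))/W_a)·S; that is, there exists t ∈ ℝⁿ with S' = t + ((W_a − (b − b'))/W_a)·S. -/
open Matrix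

/-- The width of a set `S ⊆ ℝⁿ` in the direction `v`:
`w(v, S) = sup_{x ∈ S} v·x − inf_{x ∈ S} v·x`. -/
noncomputable def width {n : ℕ} (v : Fin n → ℝ) (S : Set (Fin n → ℝ)) : ℝ :=
  sSup ((fun x => v ⬝ᵥ x) '' S) - sInf ((fun x => v ⬝ᵥ x) '' S)

section Cone

variable {E : Type*} [AddCommGroup E] [Module ℝ E] {f : E →ₗ[ℝ] ℝ} {p : E} {s : Set E} {b : ℝ}

/-- A linear functional constant on `s` is constant on the convex hull of `s`. -/
theorem eq_of_mem_convexHull_of_forall_eq (hs : ∀ y ∈ s, f y = b) {y : E}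
    (hy : y ∈ convexHull ℝ s) : f y = b :=
  convexHull_min (t := {x | f x = b}) hs (convex_hyperplane f.isLinear b) hy

/-- Points of the cone over `s` with apex `p`, when `f` is constant on `s`. -/
theorem exists_of_mem_convexHull_insert (hne : s.Nonempty) (hs : ∀ y ∈ s, f y = b) {x : E}
    (hx : x ∈ convexHull ℝ (insert p s)) :
    ∃ c ∈ Set.Icc (0 : ℝ) 1, ∃ y ∈ convexHull ℝ s,
      x = (1 - c) • p + c • y ∧ f x = (1 - c) * f p + c * b := by
  rw [convexHull_insert hne, mem_convexJoin] at hx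
  obtain ⟨_, rfl, y, hy, α, β, hα, hβ, hαβ, rfl⟩ := hx
  obtain rfl : α = 1 - β := by linarith
  refine ⟨β, ⟨hβ, by linarith⟩, y, hy, rfl, ?_⟩
  simp [eq_of_mem_convexHull_of_forall_eq hs hy]

/-- Slices of a cone parallel to its base are homothetic images of the base. -/
theorem convexHull_insert_inter_hyperplane (hne : s.Nonempty) (hs : ∀ y ∈ s, f y = b)
    (hp : f p < b) {c : ℝ} (hc : c ∈ Set.Icc (0 : ℝ) 1) :
    convexHull ℝ (insert p s) ∩ {x | f x = (1 - c) * f p + c * b} =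
      (fun x => (1 - c) • p + c • x) '' (convexHull ℝ (insert p s) ∩ {x | f x = b}) := by
  ext x
  constructor
  · rintro ⟨hx, hfx⟩
    obtain ⟨d, -, y, hy, rfl, hd⟩ := exists_of_mem_convexHull_insert hne hs hx
    have hdc : (d - c) * (b - f p) = 0 := by linear_combination hfx.symm.trans hd |>.symm
    obtain rfl : d = c := by
      rcases mul_eq_zero.mp hdc with h | h <;> linarith
    exact ⟨y, ⟨convexHull_mono (Set.subset_insert p s) hy,
      eq_of_mem_convexHull_of_forall_eq hs hy⟩, rfl⟩
  · rintro ⟨y, ⟨hy, hfy : f y = b⟩, rfl⟩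
    refine ⟨convex_convexHull ℝ _ (subset_convexHull ℝ _ (Set.mem_insert p s)) hy
      (by linarith [hc.2]) hc.1 (by ring), ?_⟩
    simp [hfy]

theorem isGreatest_image_convexHull_insert (hne : s.Nonempty) (hs : ∀ y ∈ s, f y = b)
    (hp : f p ≤ b) : IsGreatest (f '' convexHull ℝ (insert p s)) b := by
  constructor
  · obtain ⟨y, hy⟩ := hne
    exact ⟨y, subset_convexHull ℝ _ (Set.mem_insert_of_mem p hy), hs y hy⟩
  · rintro _ ⟨x, hx, rfl⟩
    obtain ⟨c, hc, -, -, -, h⟩ := exists_of_mem_convexHull_insert hne hs hx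
    nlinarith [hc.2]

theorem isLeast_image_convexHull_insert (hne : s.Nonempty) (hs : ∀ y ∈ s, f y = b)
    (hp : f p ≤ b) : IsLeast (f '' convexHull ℝ (insert p s)) (f p) := by
  constructor
  · exact ⟨p, subset_convexHull ℝ _ (Set.mem_insert p s), rfl⟩
  · rintro _ ⟨x, hx, rfl⟩
    obtain ⟨c, hc, -, -, -, h⟩ := exists_of_mem_convexHull_insert hne hs hx
    nlinarith [hc.1]

end Cone

/-- Let `Q` be a simplex (convex hull of affinely independent points `v 0, …, v k`, not
necessarily full-dimensional), and let `a·x ≤ b` be a facet-defining inequality for `Q`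
(valid on `Q`, with exactly one vertex `v i0` off the hyperplane `a·x = b`), defining the
facet `S = Q ∩ {x : a·x = b}`.  Suppose `W_a := w(a, Q) > 0`.  Then for `b' ∈ [b − W_a, b]`,
the slice `S' = Q ∩ {x : a·x = b'}` is a translate of `((W_a − (b − b'))/W_a) • S`. -/
theorem slice_is_translate_of_scaled_facet {n k : ℕ}
    (v : Fin (k + 1) → (Fin n → ℝ)) (hv : AffineIndependent ℝ v)
    (Q : Set (Fin n → ℝ)) (hQ : Q = convexHull ℝ (Set.range v))
    (a : Fin n → ℝ) (b : ℝ)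
    (hvalid : ∀ x ∈ Q, a ⬝ᵥ x ≤ b)
    (i0 : Fin (k + 1)) (hi0 : a ⬝ᵥ v i0 < b)
    (hface : ∀ j, j ≠ i0 → a ⬝ᵥ v j = b)
    (S : Set (Fin n → ℝ)) (hS : S = Q ∩ {x | a ⬝ᵥ x = b})
    (hW : 0 < width a Q)
    (b' : ℝ) (hb'1 : b - width a Q ≤ b') (hb'2 : b' ≤ b) :
    ∃ t : Fin n → ℝ,
      Q ∩ {x | a ⬝ᵥ x = b'}
        = (fun x => t + ((width a Q - (b - b')) / width a Q) • x) '' S := by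
  subst hQ hS
  have hrange : Set.range v = insert (v i0) (v '' {i0}ᶜ) := by
    rw [← Set.image_insert_eq, Set.insert_eq, Set.union_compl_self, Set.image_univ]
  rw [hrange] at hW hb'1 ⊢
  rcases (v '' {i0}ᶜ).eq_empty_or_nonempty with he | hne
  · simp [he, width] at hW
  have hs : ∀ y ∈ v '' {i0}ᶜ, dotProductBilin ℝ ℝ a y = b := by
    rintro _ ⟨j, hj, rfl⟩
    exact hface j hj
  have hp : dotProductBilin ℝ ℝ a (v i0) < b := hi0
  have hwidth : width a (convexHull ℝ (insert (v i0) (v '' {i0}ᶜ))) = b - a ⬝ᵥ v i0 :=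
    congrArg₂ (· - ·) (isGreatest_image_convexHull_insert hne hs hp.le).csSup_eq
      (isLeast_image_convexHull_insert hne hs hp.le).csInf_eq
  rw [hwidth] at hW hb'1 ⊢
  set c := (b - a ⬝ᵥ v i0 - (b - b')) / (b - a ⬝ᵥ v i0)
  have hc01 : c ∈ Set.Icc (0 : ℝ) 1 :=
    ⟨div_nonneg (by linarith) hW.le, (div_le_one hW).mpr (by linarith)⟩
  have hb' : b' = (1 - c) * (a ⬝ᵥ v i0) + c * b := by
    have : c * (b - a ⬝ᵥ v i0) = b - a ⬝ᵥ v i0 - (b - b') := div_mul_cancel₀ _ hW.ne'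
    linear_combination -this
  refine ⟨(1 - c) • v i0, ?_⟩
  clear_value c
  rw [hb']
  exact convexHull_insert_inter_hyperplane hne hs hp hc01
end

section
/- Let Q ⊆ ℝⁿ be a simplex (not necessarily full-dimensional) and let a·x ≤ b be a facet-defining inequality for Q, defining the facet S. Suppose W_a := w(a, Q) > 0. For b' ∈ [b − W_a, b], let S' := Q ∩ {x ∈ ℝⁿ : a·x = b'}. Then for every v ∈ ℝⁿ, w(v, S') = ((W_a − (b − b'))/W_a) · w(v, S). -/
open Matrix

open Set

/-- The width of a bounded nonempty set scales linearly under a homothety of nonnegative ratio. -/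
lemma width_image_homothety {n : ℕ} (w p : Fin n → ℝ) {t : ℝ} (ht : 0 ≤ t)
    {F : Set (Fin n → ℝ)} (hF : F.Nonempty) (hFc : IsCompact F) :
    width w ((fun y => (1 - t) • p + t • y) '' F) = t * width w F := by
  have hcomp : IsCompact ((fun x => w ⬝ᵥ x) '' F) :=
    hFc.image (by unfold dotProduct; fun_prop)
  have hne : ((fun x => w ⬝ᵥ x) '' F).Nonempty := hF.image _
  have himg : (fun x => w ⬝ᵥ x) '' ((fun y => (1 - t) • p + t • y) '' F) =
      (fun r : ℝ => (1 - t) * (w ⬝ᵥ p) + t * r) '' ((fun x => w ⬝ᵥ x) '' F) := by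
    simp only [image_image, dotProduct_add, dotProduct_smul, smul_eq_mul]
  have hmono : Monotone (fun r : ℝ => (1 - t) * (w ⬝ᵥ p) + t * r) := fun x y hxy => by
    dsimp only; gcongr
  have hcont : Continuous (fun r : ℝ => (1 - t) * (w ⬝ᵥ p) + t * r) := by fun_prop
  unfold width
  rw [himg, ← hmono.map_csSup_of_continuousAt hcont.continuousAt hne hcomp.bddAbove,
    ← hmono.map_csInf_of_continuousAt hcont.continuousAt hne hcomp.bddBelow]
  ring

/-- A point lies in the convex hull of `insert p T` iff it lies on a segment from `p` to a point
of the convex hull of `T`. -/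
lemma mem_convexHull_insert_iff {E : Type*} [AddCommGroup E] [Module ℝ E] {p x : E} {T : Set E}
    (hT : T.Nonempty) :
    x ∈ convexHull ℝ (insert p T) ↔
      ∃ t ∈ Icc (0 : ℝ) 1, ∃ y ∈ convexHull ℝ T, (1 - t) • p + t • y = x := by
  simp only [convexHull_insert hT, mem_convexJoin, mem_singleton_iff, exists_eq_left,
    segment_eq_image, mem_image]
  constructor
  · rintro ⟨y, hy, t, ht, h⟩
    exact ⟨t, ht, y, hy, h⟩
  · rintro ⟨t, ht, y, hy, h⟩
    exact ⟨y, hy, t, ht, h⟩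

/-- Slicing a cone with apex `p` over a base lying in the hyperplane `a·x = b` by a parallel
hyperplane gives a homothetic copy of the base. -/
lemma slice_convexHull_insert {n : ℕ} {a p : Fin n → ℝ} {b t : ℝ} {T : Set (Fin n → ℝ)}
    (hT : T.Nonempty) (hp : a ⬝ᵥ p < b) (hb : ∀ y ∈ convexHull ℝ T, a ⬝ᵥ y = b)
    (ht : t ∈ Icc (0 : ℝ) 1) :
    convexHull ℝ (insert p T) ∩ {x | a ⬝ᵥ x = (1 - t) * (a ⬝ᵥ p) + t * b} =
      (fun y => (1 - t) • p + t • y) '' convexHull ℝ T := by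
  ext x
  simp only [mem_inter_iff, mem_convexHull_insert_iff hT, mem_ofPred_eq, mem_image]
  constructor
  · rintro ⟨⟨s, -, y, hy, rfl⟩, h⟩
    simp only [dotProduct_add, dotProduct_smul, smul_eq_mul, hb y hy] at h
    have hst : s = t := by
      have h0 : (s - t) * (b - a ⬝ᵥ p) = 0 := by linarith
      rcases mul_eq_zero.1 h0 with h1 | h1 <;> linarith
    exact ⟨y, hy, by rw [hst]⟩
  · rintro ⟨y, hy, rfl⟩
    refine ⟨⟨t, ht, y, hy, rfl⟩, ?_⟩
    simp only [dotProduct_add, dotProduct_smul, smul_eq_mul, hb y hy]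

/-- The width of a cone, in the direction normal to its base, is its height. -/
lemma width_convexHull_insert {n : ℕ} {a p : Fin n → ℝ} {b : ℝ} {T : Set (Fin n → ℝ)}
    (hT : T.Nonempty) (hp : a ⬝ᵥ p < b) (hb : ∀ y ∈ convexHull ℝ T, a ⬝ᵥ y = b) :
    width a (convexHull ℝ (insert p T)) = b - a ⬝ᵥ p := by
  have hbounds : ∀ x ∈ convexHull ℝ (insert p T), a ⬝ᵥ p ≤ a ⬝ᵥ x ∧ a ⬝ᵥ x ≤ b := by
    intro x hx
    obtain ⟨t, ⟨h0, h1⟩, y, hy, rfl⟩ := (mem_convexHull_insert_iff hT).1 hx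
    simp only [dotProduct_add, dotProduct_smul, smul_eq_mul, hb y hy]
    constructor <;> nlinarith
  obtain ⟨y, hy⟩ := hT
  have hgreatest : IsGreatest ((fun x => a ⬝ᵥ x) '' convexHull ℝ (insert p T)) b :=
    ⟨⟨y, subset_convexHull ℝ _ (mem_insert_of_mem _ hy), hb y (subset_convexHull ℝ _ hy)⟩,
      forall_mem_image.2 fun x hx => (hbounds x hx).2⟩
  have hleast : IsLeast ((fun x => a ⬝ᵥ x) '' convexHull ℝ (insert p T)) (a ⬝ᵥ p) :=
    ⟨⟨p, subset_convexHull ℝ _ (mem_insert _ _), rfl⟩,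
      forall_mem_image.2 fun x hx => (hbounds x hx).1⟩
  rw [width, hgreatest.csSup_eq, hleast.csInf_eq]

/-- Let `Q` be a simplex (convex hull of affinely independent points, not necessarily
full-dimensional), `a·x ≤ b` a facet-defining inequality for `Q` defining the facet
`S = Q ∩ {x : a·x = b}`, and suppose `W_a := w(a, Q) > 0`.  Then for `b' ∈ [b − W_a, b]`
and the slice `S' = Q ∩ {x : a·x = b'}`, one has
`w(v, S') = ((W_a − (b − b'))/W_a) · w(v, S)` for every direction `v`. -/
theorem width_of_slice {n k : ℕ}
    (v : Fin (k + 1) → (Fin n → ℝ)) (hv : AffineIndependent ℝ v)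
    (Q : Set (Fin n → ℝ)) (hQ : Q = convexHull ℝ (Set.range v))
    (a : Fin n → ℝ) (b : ℝ)
    (hvalid : ∀ x ∈ Q, a ⬝ᵥ x ≤ b)
    (i0 : Fin (k + 1)) (hi0 : a ⬝ᵥ v i0 < b)
    (hface : ∀ j, j ≠ i0 → a ⬝ᵥ v j = b)
    (S : Set (Fin n → ℝ)) (hS : S = Q ∩ {x | a ⬝ᵥ x = b})
    (hW : 0 < width a Q)
    (b' : ℝ) (hb'1 : b - width a Q ≤ b') (hb'2 : b' ≤ b)
    (S' : Set (Fin n → ℝ)) (hS' : S' = Q ∩ {x | a ⬝ᵥ x = b'}) :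
    ∀ w : Fin n → ℝ,
      width w S' = ((width a Q - (b - b')) / width a Q) * width w S := by
  intro w
  have hrange : range v = insert (v i0) (v '' {i0}ᶜ) := by
    rw [← image_insert_eq, insert_eq, union_compl_self, image_univ]
  rw [hrange] at hQ
  have hT : (v '' {i0}ᶜ).Nonempty := by
    rw [nonempty_iff_ne_empty]
    intro hempty
    rw [hQ, hempty] at hW
    simp [width] at hW
  have hb : ∀ y ∈ convexHull ℝ (v '' {i0}ᶜ), a ⬝ᵥ y = b := by
    have hconv : Convex ℝ {y | a ⬝ᵥ y = b} :=
      convex_hyperplane (𝕜 := ℝ) ⟨dotProduct_add a, fun c x => dotProduct_smul c a x⟩ b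
    exact convexHull_min (image_subset_iff.2 hface) hconv
  have hcompact : IsCompact (convexHull ℝ (v '' {i0}ᶜ)) :=
    (toFinite (v '' {i0}ᶜ)).isCompact_convexHull ℝ
  have hwidth : width a Q = b - a ⬝ᵥ v i0 := hQ ▸ width_convexHull_insert hT hi0 hb
  have hSF : S = convexHull ℝ (v '' {i0}ᶜ) := by
    have h := slice_convexHull_insert (t := 1) hT hi0 hb (by simp)
    simpa [← hQ, ← hS] using h
  set t := (width a Q - (b - b')) / width a Q
  have ht : t ∈ Icc (0 : ℝ) 1 :=
    ⟨div_nonneg (by linarith) hW.le, (div_le_one hW).2 (by linarith)⟩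
  have hlevel : b' = (1 - t) * (a ⬝ᵥ v i0) + t * b := by
    have h : t * width a Q = width a Q - (b - b') := div_mul_cancel₀ _ hW.ne'
    rw [hwidth] at h
    linarith
  have hslice := slice_convexHull_insert hT hi0 hb ht
  rw [← hlevel, ← hQ, ← hS'] at hslice
  rw [hslice, hSF, width_image_homothety w (v i0) ht.1 hT.convexHull hcompact]
end

section
/- For every fixed W ∈ ℕ there exist constants C, d ∈ ℕ (depending only on W) such that the following holds for every n ≥ 1: if S = {x ∈ ℝⁿ : Ax ≤ b} is a full-dimensional simplex with A ∈ ℤ^{(n+1)×n} and b ∈ ℝ^{n+1}, and the facet widths corresponding to the first n rows of A are each at most W, then the number of integer points in S satisfies |S ∩ ℤⁿ| ≤ C · n^d. -/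
open Matrix

/-- The integer points of `ℝⁿ`. -/
def intPts (n : ℕ) : Set (Fin n → ℝ) := {x | ∀ i, ∃ z : ℤ, x i = (z : ℝ)}

/-- The width of a bounded set bounds the difference of the values of a functional on it. -/
lemma dotProduct_sub_le_width {n : ℕ} (v : Fin n → ℝ) {S : Set (Fin n → ℝ)}
    (hS : Bornology.IsBounded S) {x y : Fin n → ℝ} (hx : x ∈ S) (hy : y ∈ S) :
    v ⬝ᵥ x - v ⬝ᵥ y ≤ width v S := by
  have hc : IsCompact ((fun x => v ⬝ᵥ x) '' closure S) :=
    hS.isCompact_closure.image (by fun_prop)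
  have hsub : (fun x => v ⬝ᵥ x) '' S ⊆ (fun x => v ⬝ᵥ x) '' closure S :=
    Set.image_mono subset_closure
  exact sub_le_sub (le_csSup (hc.bddAbove.mono hsub) ⟨x, hx, rfl⟩)
    (csInf_le (hc.bddBelow.mono hsub) ⟨y, hy, rfl⟩)

/-- A nonempty bounded polyhedron has trivial recession cone. -/
lemma eq_zero_of_mulVec_nonpos {m n : ℕ} {M : Matrix (Fin m) (Fin n) ℝ} {b : Fin m → ℝ}
    (hS : Bornology.IsBounded {x | M.mulVec x ≤ b}) {x₀ : Fin n → ℝ} (hx₀ : M.mulVec x₀ ≤ b)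
    {d : Fin n → ℝ} (hd : M.mulVec d ≤ 0) : d = 0 := by
  by_contra hne
  have hpos : 0 < ‖d‖ := norm_pos_iff.mpr hne
  obtain ⟨R, hR⟩ := hS.exists_norm_le
  have hR₀ : 0 ≤ R := (norm_nonneg _).trans (hR x₀ hx₀)
  set t : ℝ := (R + ‖x₀‖ + 1) / ‖d‖ with ht
  have ht₀ : 0 ≤ t := by positivity
  have hmem : M.mulVec (x₀ + t • d) ≤ b := fun i => by
    have h₁ := hx₀ i
    have h₂ := mul_nonpos_of_nonneg_of_nonpos ht₀ (hd i)
    simp only [mulVec_add, mulVec_smul, Pi.add_apply, Pi.smul_apply, smul_eq_mul]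
    linarith
  have h₁ : ‖t • d‖ ≤ ‖x₀ + t • d‖ + ‖x₀‖ := by
    simpa using norm_sub_le (x₀ + t • d) x₀
  have h₂ : ‖t • d‖ = R + ‖x₀‖ + 1 := by
    rw [norm_smul, Real.norm_of_nonneg ht₀, ht, div_mul_cancel₀ _ hpos.ne']
  linarith [hR _ hmem]

/-- The first `n` facet normals of a nonempty bounded polyhedron with `n + 1` constraints are
linearly independent. -/
lemma isUnit_submatrix_castSucc {n : ℕ} {M : Matrix (Fin (n + 1)) (Fin n) ℝ}
    {b : Fin (n + 1) → ℝ} (hS : Bornology.IsBounded {x | M.mulVec x ≤ b})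
    {x₀ : Fin n → ℝ} (hx₀ : M.mulVec x₀ ≤ b) : IsUnit (M.submatrix Fin.castSucc id) := by
  rw [← mulVec_injective_iff_isUnit]
  refine (injective_iff_map_eq_zero (M.submatrix Fin.castSucc id).mulVecLin).mpr fun d hd => ?_
  have hrow (i : Fin n) : M.mulVec d i.castSucc = 0 := congrFun hd i
  rcases le_total (M.mulVec d (Fin.last n)) 0 with h | h
  · refine eq_zero_of_mulVec_nonpos hS hx₀ fun i => ?_
    induction i using Fin.lastCases with
    | last => exact h
    | cast i => exact (hrow i).le
  · refine neg_eq_zero.mp (eq_zero_of_mulVec_nonpos hS hx₀ fun i => ?_)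
    rw [mulVec_neg]
    induction i using Fin.lastCases with
    | last => simpa using h
    | cast i => simp [hrow i]

/-- If the first `n` facet widths of a simplex are at most `W`, then the corresponding slacks of
each of its points sum up to at most `W`. -/
lemma sum_slack_le {n : ℕ} {M : Matrix (Fin (n + 1)) (Fin n) ℝ} {b : Fin (n + 1) → ℝ} {W : ℝ}
    (hW : 0 ≤ W) (hS : Bornology.IsBounded {x | M.mulVec x ≤ b})
    (hw : ∀ i : Fin n, width (M i.castSucc) {x | M.mulVec x ≤ b} ≤ W)
    {x : Fin n → ℝ} (hx : M.mulVec x ≤ b) :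
    ∑ i : Fin n, (b i.castSucc - M.mulVec x i.castSucc) ≤ W := by
  set B := M.submatrix Fin.castSucc id
  have hB : IsUnit B := isUnit_submatrix_castSucc hS hx
  have hinj := mulVec_injective_iff_isUnit.mpr hB
  have hsurj := mulVec_surjective_iff_isUnit.mpr hB
  obtain ⟨v, hv⟩ := hsurj fun i => b i.castSucc
  choose u hu using fun i : Fin n => hsurj (-Pi.single i 1)
  have hv' (j : Fin n) : M.mulVec v j.castSucc = b j.castSucc := congrFun hv j
  have hu' (i j : Fin n) : M.mulVec (u i) j.castSucc = -Pi.single (M := fun _ => ℝ) i 1 j :=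
    congrFun (hu i) j
  set α : Fin n → ℝ := fun i => M.mulVec (u i) (Fin.last n)
  set y : Fin n → ℝ := fun i => b i.castSucc - M.mulVec x i.castSucc
  set β : ℝ := b (Fin.last n) - M.mulVec v (Fin.last n)
  have hy (i : Fin n) : 0 ≤ y i := sub_nonneg.mpr (hx i.castSucc)
  have hα (i : Fin n) : 0 < α i := by
    by_contra! h
    have hu₀ : u i = 0 := by
      refine eq_zero_of_mulVec_nonpos hS hx fun j => ?_
      induction j using Fin.lastCases with
      | last => exact h
      | cast j =>
        rw [hu']
        simp only [Pi.single_apply, Pi.zero_apply]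
        split_ifs <;> norm_num
    have := hu' i i
    simp [hu₀] at this
  have hxv : x = v + ∑ i, y i • u i := by
    refine hinj ?_
    ext j
    have : B.mulVec x j = M.mulVec x j.castSucc := rfl
    rw [mulVec_add, mulVec_sum, hv, this]
    simp [mulVec_smul, hu, Finset.sum_apply, Pi.single_apply, y]
  have hsum : ∑ i, α i * y i ≤ β := by
    have h := hx (Fin.last n)
    rw [hxv, mulVec_add, mulVec_sum] at h
    simp only [mulVec_smul, Pi.add_apply, Finset.sum_apply, Pi.smul_apply, smul_eq_mul] at h
    simp only [mul_comm (α _), β]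
    exact le_sub_iff_add_le'.mpr h
  have hβ : 0 ≤ β := (Finset.sum_nonneg fun i _ => mul_nonneg (hα i).le (hy i)).trans hsum
  have hmem (i : Fin n) (t : ℝ) (ht : 0 ≤ t) (htβ : t * α i ≤ β) :
      v + t • u i ∈ {x | M.mulVec x ≤ b} := fun j => by
    rw [mulVec_add, mulVec_smul]
    induction j using Fin.lastCases with
    | last => exact le_sub_iff_add_le'.mp htβ
    | cast j =>
      simp only [Pi.add_apply, Pi.smul_apply, smul_eq_mul, hv', hu', Pi.single_apply]
      split_ifs <;> simp [ht]
  have hβW (i : Fin n) : β ≤ W * α i := by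
    have h₀ := hmem i 0 le_rfl (by simpa using hβ)
    have h₁ := hmem i (β / α i) (div_nonneg hβ (hα i).le) (div_mul_cancel₀ _ (hα i).ne').le
    have h := (dotProduct_sub_le_width (M i.castSucc) hS h₀ h₁).trans (hw i)
    have hd : M i.castSucc ⬝ᵥ u i = -1 := (hu' i i).trans (by simp)
    rw [dotProduct_add, dotProduct_add, dotProduct_smul, dotProduct_smul, hd] at h
    rw [← div_le_iff₀ (hα i)]
    simpa using h
  rcases hβ.eq_or_lt with h₀ | hpos
  · have hz : ∀ i ∈ Finset.univ, α i * y i = 0 :=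
      (Finset.sum_eq_zero_iff_of_nonneg fun i _ => mul_nonneg (hα i).le (hy i)).mp
        (le_antisymm (hsum.trans h₀.ge)
          (Finset.sum_nonneg fun i _ => mul_nonneg (hα i).le (hy i)))
    rw [Finset.sum_eq_zero fun i hi => (mul_eq_zero.mp (hz i hi)).resolve_left (hα i).ne']
    exact hW
  · refine le_of_mul_le_mul_left ?_ hpos
    calc β * ∑ i, y i = ∑ i, β * y i := Finset.mul_sum ..
      _ ≤ ∑ i, W * (α i * y i) := Finset.sum_le_sum fun i _ => by
          rw [← mul_assoc]; exact mul_le_mul_of_nonneg_right (hβW i) (hy i)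
      _ = W * ∑ i, α i * y i := (Finset.mul_sum ..).symm
      _ ≤ β * W := by rw [mul_comm β]; exact mul_le_mul_of_nonneg_left hsum hW

/-- The vectors in `ℕⁿ` with coordinate sum at most `W` inject into the multisets of size `W`
on `n + 1` elements. -/
lemma exists_injective_sym (n W : ℕ) :
    ∃ f : {k : Fin n → ℕ // ∑ i, k i ≤ W} → Sym (Fin (n + 1)) W, Function.Injective f := by
  refine ⟨fun k => (Sym.equivNatSumOfFintype (Fin (n + 1)) W).symm
    ⟨Fin.snoc (α := fun _ => ℕ) k.1 (W - ∑ i, k.1 i), ?_⟩, fun k l h => ?_⟩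
  · simp [Fin.sum_univ_castSucc, k.2]
  · have h := congrArg Subtype.val ((Equiv.injective _) h)
    ext i
    simpa using congrFun h i.castSucc

lemma card_sym_fin_succ_le {n : ℕ} (hn : 1 ≤ n) (W : ℕ) :
    Fintype.card (Sym (Fin (n + 1)) W) ≤ (W + 1) ^ W * n ^ W := by
  rw [Sym.card_sym_eq_multichoose, Fintype.card_fin, Nat.multichoose_eq, ← mul_pow]
  refine (Nat.choose_le_pow _ _).trans (Nat.pow_le_pow_left ?_ _)
  have : n + 1 + W - 1 = n + W := by omega
  rw [this]
  nlinarith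

lemma exists_int_mulVec_eq {m n : ℕ} (A : Matrix (Fin m) (Fin n) ℤ) {x : Fin n → ℝ}
    (hx : x ∈ intPts n) (i : Fin m) :
    ∃ z : ℤ, (A.map (Int.cast : ℤ → ℝ)).mulVec x i = z := by
  choose z hz using hx
  exact ⟨∑ j, A i j * z j, by simp [mulVec, dotProduct, hz]⟩

/-- Nonnegative reals with equal integer parts that are congruent modulo `ℤ` are equal. -/
lemma eq_of_natFloor_eq_of_sub_eq_intCast {s t : ℝ} (hs : 0 ≤ s) (ht : 0 ≤ t)
    (h : ⌊s⌋₊ = ⌊t⌋₊) {z : ℤ} (hz : s - t = z) : s = t := by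
  have h₁ := Nat.floor_le hs
  have h₂ := Nat.lt_floor_add_one s
  have h₃ := Nat.floor_le ht
  have h₄ := Nat.lt_floor_add_one t
  rw [h] at h₁ h₂
  have h₅ : (z : ℝ) < 1 := by linarith
  have h₆ : (-1 : ℝ) < z := by linarith
  have h₇ : z < 1 := by exact_mod_cast h₅
  have h₈ : -1 < z := by exact_mod_cast h₆
  have : z = 0 := by omega
  rw [this, Int.cast_zero, sub_eq_zero] at hz
  exact hz

/-- For every fixed `W ∈ ℕ` there are constants `C, d` (depending only on `W`) such that for
all `n ≥ 1`: if `S = {x ∈ ℝⁿ : Ax ≤ b}` is a full-dimensional simplex (a bounded,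
full-dimensional polytope given by `n+1` integral constraints) with `A ∈ ℤ^{(n+1)×n}`,
`b ∈ ℝ^{n+1}`, whose facet widths for the first `n` rows are all at most `W`, then
`|S ∩ ℤⁿ| ≤ C · n^d`. -/
theorem card_intPts_polynomial_of_bounded_facet_widths (W : ℕ) :
    ∃ C d : ℕ, ∀ n : ℕ, 1 ≤ n →
      ∀ (A : Matrix (Fin (n + 1)) (Fin n) ℤ) (b : Fin (n + 1) → ℝ)
        (S : Set (Fin n → ℝ)),
        S = {x | (A.map (Int.cast : ℤ → ℝ)).mulVec x ≤ b} →
        Bornology.IsBounded S → (interior S).Nonempty →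
        (∀ i : Fin n, width ((A.map (Int.cast : ℤ → ℝ)) i.castSucc) S ≤ (W : ℝ)) →
        (S ∩ intPts n).ncard ≤ C * n ^ d := by
  refine ⟨(W + 1) ^ W, W, ?_⟩
  rintro n hn A b _ rfl hS - hw
  set M := A.map (Int.cast : ℤ → ℝ)
  refine le_trans ?_ (card_sym_fin_succ_le hn W)
  obtain ⟨f, hf⟩ := exists_injective_sym n W
  have hsum (x : ↥({x | M.mulVec x ≤ b} ∩ intPts n)) :
      ∑ i : Fin n, ⌊b i.castSucc - M.mulVec x.1 i.castSucc⌋₊ ≤ W := by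
    have h := sum_slack_le W.cast_nonneg hS hw x.2.1
    have h' : ∑ i : Fin n, (⌊b i.castSucc - M.mulVec x.1 i.castSucc⌋₊ : ℝ) ≤ W :=
      (Finset.sum_le_sum fun i _ => Nat.floor_le (sub_nonneg.mpr (x.2.1 i.castSucc))).trans h
    exact_mod_cast h'
  rw [← Nat.card_coe_set_eq, ← Nat.card_eq_fintype_card]
  refine Nat.card_le_card_of_injective (fun x => f ⟨_, hsum x⟩) fun x y hxy => ?_
  have hfloor := congrArg Subtype.val (hf hxy)
  refine Subtype.ext (mulVec_injective_iff_isUnit.mpr (isUnit_submatrix_castSucc hS x.2.1) ?_)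
  ext i
  change M.mulVec x.1 i.castSucc = M.mulVec y.1 i.castSucc
  obtain ⟨p, hp⟩ := exists_int_mulVec_eq A x.2.2 i.castSucc
  obtain ⟨q, hq⟩ := exists_int_mulVec_eq A y.2.2 i.castSucc
  refine sub_right_injective (b := b i.castSucc) <| eq_of_natFloor_eq_of_sub_eq_intCast (z := q - p)
    (sub_nonneg.mpr (x.2.1 i.castSucc)) (sub_nonneg.mpr (y.2.1 i.castSucc)) (congrFun hfloor i) ?_
  push_cast
  rw [← hp, ← hq]
  ring
end

section
/- There exists a function f : ℕ → ℕ with the following property: for every n ≥ 1 and every full-dimensional simplex S = {x ∈ ℝⁿ : Ax ≤ b} with A ∈ ℤ^{(n+1)×n} and b ∈ ℝ^{n+1}, if W_min denotes the smallest facet width of S, then every facet width of S is at most W_min · f(Δ_A). -/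
open Matrix

/-- `Δ_A`: the maximum absolute value of an `n × n` subdeterminant of `A ∈ ℤ^{m×n}`. -/
noncomputable def maxSubdet {m n : ℕ} (A : Matrix (Fin m) (Fin n) ℤ) : ℕ :=
  Finset.univ.sup fun g : Fin n ↪ Fin m => ((A.submatrix g id).det).natAbs

/-- The signed maximal minors of an `(n + 1) × n` matrix form a linear relation among its rows. -/
theorem sum_signed_minor_mul_eq_zero {R : Type*} [CommRing R] {n : ℕ}
    (A : Matrix (Fin (n + 1)) (Fin n) R) (k : Fin n) :
    ∑ i : Fin (n + 1), (-1) ^ (i : ℕ) * (A.submatrix i.succAbove id).det * A i k = 0 := by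
  let M : Matrix (Fin (n + 1)) (Fin (n + 1)) R :=
    Matrix.of fun i j => Fin.cases (A i k) (fun l => A i l) j
  have hM : M.det = 0 :=
    Matrix.det_zero_of_column_eq (Fin.succ_ne_zero k).symm (fun i => by simp [M])
  rw [Matrix.det_succ_column_zero] at hM
  rw [← hM]
  refine Finset.sum_congr rfl fun i _ => ?_
  have h : M.submatrix i.succAbove Fin.succ = A.submatrix i.succAbove id := by
    ext a b
    simp [M]
  rw [h]
  simp only [M, Matrix.of_apply, Fin.cases_zero]
  ring

/-- A nonempty bounded polyhedron has a trivial recession cone. -/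
theorem eq_zero_of_mulVec_nonpos_s5 {m n : ℕ} {B : Matrix (Fin m) (Fin n) ℝ} {b : Fin m → ℝ}
    (hbdd : Bornology.IsBounded {x | B *ᵥ x ≤ b}) {p : Fin n → ℝ} (hp : B *ᵥ p ≤ b)
    {x : Fin n → ℝ} (hx : B *ᵥ x ≤ 0) : x = 0 := by
  by_contra hne
  obtain ⟨R, hR⟩ := hbdd.exists_norm_le
  have hpos : 0 < ‖x‖ := norm_pos_iff.mpr hne
  have hR0 : 0 ≤ R := (norm_nonneg p).trans (hR p hp)
  set t : ℝ := (R + ‖p‖ + 1) / ‖x‖ with ht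
  have ht0 : 0 ≤ t := by positivity
  have hmem : p + t • x ∈ {x | B *ᵥ x ≤ b} := by
    intro i
    have h1 := hp i
    have h2 := mul_nonpos_of_nonneg_of_nonpos ht0 (hx i)
    simp only [Matrix.mulVec_add, Matrix.mulVec_smul, Pi.add_apply, Pi.smul_apply, smul_eq_mul]
    linarith
  have h1 := hR _ hmem
  have h2 : ‖t • x‖ ≤ ‖p + t • x‖ + ‖p‖ := by
    simpa using norm_sub_le (p + t • x) p
  have h3 : ‖t • x‖ = R + ‖p‖ + 1 := by
    rw [norm_smul, Real.norm_of_nonneg ht0, ht, div_mul_cancel₀ _ hpos.ne']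
  linarith

/-- The maximal minors of a matrix with trivial recession cone do not vanish. -/
theorem minor_ne_zero {n : ℕ} {B : Matrix (Fin (n + 1)) (Fin n) ℝ}
    (hB : ∀ x, B *ᵥ x ≤ 0 → x = 0) (i : Fin (n + 1)) :
    (B.submatrix i.succAbove id).det ≠ 0 := by
  intro h
  obtain ⟨x, hx, hx0⟩ := Matrix.exists_mulVec_eq_zero_iff.mpr h
  have hrow : ∀ k, (B *ᵥ x) (i.succAbove k) = 0 := fun k => congrFun hx0 k
  rcases le_total ((B *ᵥ x) i) 0 with hi | hi
  · refine hx (hB x fun j => ?_)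
    induction j using Fin.succAboveCases i with
    | x => exact hi
    | p k => exact (hrow k).le
  · refine hx (neg_eq_zero.mp (hB (-x) fun j => ?_))
    rw [Matrix.mulVec_neg]
    induction j using Fin.succAboveCases i with
    | x => simpa using hi
    | p k => simp [hrow k]

/-- If the maximal minor omitting row `i` is nonzero, the other rows take arbitrary values. -/
theorem exists_mulVec_eq_off {n : ℕ} {B : Matrix (Fin (n + 1)) (Fin n) ℝ} {i : Fin (n + 1)}
    (h : (B.submatrix i.succAbove id).det ≠ 0) (y : Fin (n + 1) → ℝ) :
    ∃ x, ∀ j, j ≠ i → (B *ᵥ x) j = y j := by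
  obtain ⟨x, hx⟩ := Matrix.mulVec_surjective_iff_isUnit.mpr
    ((Matrix.isUnit_iff_isUnit_det _).mpr h.isUnit) (fun k => y (i.succAbove k))
  refine ⟨x, fun j hj => ?_⟩
  obtain ⟨k, rfl⟩ := Fin.exists_succAbove_eq hj
  exact congrFun hx k

/-- A linear relation among the rows of `B` annihilates the range of `B`. -/
theorem sum_mul_mulVec_eq_zero {m n : ℕ} {B : Matrix (Fin m) (Fin n) ℝ} {c : Fin m → ℝ}
    (hc : ∀ k, ∑ i, c i * B i k = 0) (x : Fin n → ℝ) : ∑ i, c i * (B *ᵥ x) i = 0 := by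
  have h : c ᵥ* B = 0 := funext hc
  have h2 := Matrix.dotProduct_mulVec c B x
  rwa [h, zero_dotProduct] at h2

/-- For a matrix with trivial recession cone, the absolute values of the maximal minors form a
linear relation among the rows. -/
theorem sum_abs_minor_mul_eq_zero {n : ℕ} {B : Matrix (Fin (n + 1)) (Fin n) ℝ}
    (hB : ∀ x, B *ᵥ x ≤ 0 → x = 0) (k : Fin n) :
    ∑ i : Fin (n + 1), |(B.submatrix i.succAbove id).det| * B i k = 0 := by
  set c : Fin (n + 1) → ℝ := fun i => (-1) ^ (i : ℕ) * (B.submatrix i.succAbove id).det with hcdef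
  have hc0 : ∀ i, c i ≠ 0 := fun i =>
    mul_ne_zero (pow_ne_zero _ (by norm_num)) (minor_ne_zero hB i)
  have hrel : ∀ k, ∑ i, c i * B i k = 0 := sum_signed_minor_mul_eq_zero B
  have habs : ∀ i : Fin (n + 1), |(B.submatrix i.succAbove id).det| = |c i| := fun i => by
    simp [hcdef, abs_mul]
  have hsign : ∀ i, 0 < c 0 * c i := by
    intro i
    by_contra hneg
    have hneg : c 0 * c i < 0 := lt_of_le_of_ne (not_lt.mp hneg) (mul_ne_zero (hc0 0) (hc0 i))
    have hi : i ≠ 0 := by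
      rintro rfl
      exact absurd hneg (not_lt.mpr (mul_self_nonneg _))
    obtain ⟨x, hx⟩ := exists_mulVec_eq_off (minor_ne_zero hB 0) (-Pi.single i 1)
    have hxi : (B *ᵥ x) i = -1 := by simp [hx i hi]
    have hsum := sum_mul_mulVec_eq_zero hrel x
    rw [Fintype.sum_eq_add 0 i hi.symm (fun j hj => by simp [hx j hj.1, hj.2]), hxi] at hsum
    have hx0 : (B *ᵥ x) 0 < 0 := by
      have h1 : c 0 ^ 2 * (B *ᵥ x) 0 = c 0 * c i := by linear_combination c 0 * hsum
      have h2 : 0 < c 0 ^ 2 := by have := hc0 0; positivity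
      by_contra h3
      have := mul_nonneg h2.le (not_lt.mp h3)
      linarith
    have hzero : x = 0 := hB x fun j => by
      by_cases hj : j = 0
      · exact hj ▸ hx0.le
      · by_cases hji : j = i
        · rw [hji, hxi]; simp
        · simp [hx j hj, hji]
    simp [hzero] at hxi
  have hmul : |c 0| * ∑ i : Fin (n + 1), |(B.submatrix i.succAbove id).det| * B i k = 0 := by
    rw [Finset.mul_sum, ← mul_zero (c 0), ← hrel k, Finset.mul_sum]
    refine Finset.sum_congr rfl fun i _ => ?_
    rw [habs, ← mul_assoc, ← abs_mul, abs_of_pos (hsign i), mul_assoc]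
  exact (mul_eq_zero.mp hmul).resolve_left (abs_ne_zero.mpr (hc0 0))

/-- The facet widths of a simplex are inversely proportional to the coefficients of a positive
linear relation among the facet normals. -/
theorem width_row_eq {n : ℕ} (hn : 1 ≤ n) {B : Matrix (Fin (n + 1)) (Fin n) ℝ}
    {b c : Fin (n + 1) → ℝ} (hdet : ∀ i : Fin (n + 1), (B.submatrix i.succAbove id).det ≠ 0)
    (hc : ∀ i, 0 < c i) (hrel : ∀ k, ∑ i, c i * B i k = 0)
    (hb : 0 ≤ ∑ i, c i * b i) (i : Fin (n + 1)) :
    width (B i) {x | B *ᵥ x ≤ b} = (∑ i, c i * b i) / c i := by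
  have hslack : ∀ x, ∑ j, c j * (b j - (B *ᵥ x) j) = ∑ j, c j * b j := fun x => by
    simp only [mul_sub, Finset.sum_sub_distrib, sum_mul_mulVec_eq_zero hrel x, sub_zero]
  have hvertex : ∀ j, ∃ x ∈ {x | B *ᵥ x ≤ b}, (∀ l, l ≠ j → (B *ᵥ x) l = b l) ∧
      (B *ᵥ x) j = b j - (∑ i, c i * b i) / c j := by
    intro j
    obtain ⟨x, hx⟩ := exists_mulVec_eq_off (hdet j) b
    have h := hslack x
    rw [Fintype.sum_eq_single j (fun l hl => by simp [hx l hl])] at h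
    have hj : (B *ᵥ x) j = b j - (∑ i, c i * b i) / c j := by
      rw [← h, mul_div_cancel_left₀ _ (hc j).ne']
      ring
    refine ⟨x, fun l => ?_, hx, hj⟩
    by_cases hl : l = j
    · rw [hl, hj]
      have := div_nonneg hb (hc j).le
      linarith
    · exact (hx l hl).le
  have : Nontrivial (Fin (n + 1)) := Fin.nontrivial_iff_two_le.mpr (by omega)
  obtain ⟨j, hj⟩ := exists_ne i
  have hmax : IsGreatest ((fun x => B i ⬝ᵥ x) '' {x | B *ᵥ x ≤ b}) (b i) := by
    obtain ⟨x, hxS, hx, -⟩ := hvertex j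
    refine ⟨⟨x, hxS, hx i hj.symm⟩, ?_⟩
    rintro _ ⟨y, hy, rfl⟩
    exact hy i
  have hmin : IsLeast ((fun x => B i ⬝ᵥ x) '' {x | B *ᵥ x ≤ b})
      (b i - (∑ i, c i * b i) / c i) := by
    obtain ⟨x, hxS, -, hx⟩ := hvertex i
    refine ⟨⟨x, hxS, hx⟩, ?_⟩
    rintro _ ⟨y, hy, rfl⟩
    have h : c i * (b i - (B *ᵥ y) i) ≤ ∑ j, c j * b j := by
      rw [← hslack y]
      exact Finset.single_le_sum (f := fun j => c j * (b j - (B *ᵥ y) j))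
        (fun l _ => mul_nonneg (hc l).le (sub_nonneg.mpr (hy l))) (Finset.mem_univ i)
    have h2 : b i - (B *ᵥ y) i ≤ (∑ j, c j * b j) / c i := by
      rwa [le_div_iff₀ (hc i), mul_comm]
    change _ ≤ (B *ᵥ y) i
    linarith
  rw [width, hmax.csSup_eq, hmin.csInf_eq, sub_sub_cancel]

/-- The minors of an `(n + 1) × n` matrix omitting one row are bounded by `maxSubdet`. -/
theorem natAbs_minor_le_maxSubdet {n : ℕ} (A : Matrix (Fin (n + 1)) (Fin n) ℤ)
    (i : Fin (n + 1)) : (A.submatrix i.succAbove id).det.natAbs ≤ maxSubdet A :=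
  Finset.le_sup (f := fun g : Fin n ↪ Fin (n + 1) => ((A.submatrix g id).det).natAbs)
    (Finset.mem_univ i.succAboveEmb)

/-- There is a function `f : ℕ → ℕ` such that for every `n ≥ 1` and every full-dimensional
simplex `S = {x ∈ ℝⁿ : Ax ≤ b}` with `A ∈ ℤ^{(n+1)×n}` and `b ∈ ℝ^{n+1}`, every facet width
of `S` is at most `W_min · f(Δ_A)`, where `W_min` is the smallest facet width; equivalently,
`w(a_i, S) ≤ w(a_j, S) · f(Δ_A)` for all rows `a_i, a_j` of `A`. -/
theorem facet_widths_bounded_by_min_facet_width :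
    ∃ f : ℕ → ℕ, ∀ n : ℕ, 1 ≤ n →
      ∀ (A : Matrix (Fin (n + 1)) (Fin n) ℤ) (b : Fin (n + 1) → ℝ)
        (S : Set (Fin n → ℝ)),
        S = {x | (A.map (Int.cast : ℤ → ℝ)).mulVec x ≤ b} →
        Bornology.IsBounded S → (interior S).Nonempty →
        ∀ i j : Fin (n + 1),
          width ((A.map (Int.cast : ℤ → ℝ)) i) S
            ≤ width ((A.map (Int.cast : ℤ → ℝ)) j) S * (f (maxSubdet A) : ℝ) := by
  refine ⟨id, fun n hn A b S hS hbdd hne i j => ?_⟩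
  subst hS
  obtain ⟨p, hp⟩ := hne.mono interior_subset
  set B : Matrix (Fin (n + 1)) (Fin n) ℝ := A.map (Int.cast : ℤ → ℝ)
  have hB : ∀ x, B *ᵥ x ≤ 0 → x = 0 := fun x hx => eq_zero_of_mulVec_nonpos_s5 hbdd hp hx
  have hcast : ∀ i : Fin (n + 1), |(B.submatrix i.succAbove id).det| =
      ((A.submatrix i.succAbove id).det.natAbs : ℝ) := fun i => by
    have h : (B.submatrix i.succAbove id).det = ((A.submatrix i.succAbove id).det : ℝ) :=
      (Int.cast_det (A.submatrix i.succAbove id)).symm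
    rw [h, Nat.cast_natAbs, Int.cast_abs]
  set c : Fin (n + 1) → ℝ := fun i => |(B.submatrix i.succAbove id).det| with hcdef
  have hrel : ∀ k, ∑ i, c i * B i k = 0 := sum_abs_minor_mul_eq_zero hB
  have hdet := minor_ne_zero hB
  have hc : ∀ i, 0 < c i := fun i => abs_pos.mpr (hdet i)
  have hone : 1 ≤ c i := by
    have h := hc i
    simp only [hcdef, hcast] at h ⊢
    exact_mod_cast h
  have hle : c j ≤ maxSubdet A := by
    simp only [hcdef, hcast]
    exact_mod_cast natAbs_minor_le_maxSubdet A j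
  have hb : 0 ≤ ∑ i, c i * b i := by
    rw [← sum_mul_mulVec_eq_zero hrel p]
    exact Finset.sum_le_sum fun l _ => mul_le_mul_of_nonneg_left (hp l) (hc l).le
  rw [width_row_eq hn hdet hc hrel hb, width_row_eq hn hdet hc hrel hb]
  calc (∑ i, c i * b i) / c i ≤ ∑ i, c i * b i := div_le_self hb hone
    _ = (∑ i, c i * b i) / c j * c j := (div_mul_cancel₀ _ (hc j).ne').symm
    _ ≤ (∑ i, c i * b i) / c j * (id (maxSubdet A) : ℕ) :=
      mul_le_mul_of_nonneg_left hle (div_nonneg hb (hc j).le)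
end

section
/- Let A ∈ ℝ^{(n+1)×n} and b ∈ ℝ^{n+1} be such that P = {x ∈ ℝⁿ : Ax ≤ b} is a full-dimensional simplex. Let Â be the matrix formed by the first n rows of A (which is invertible), let a_i denote the i-th row of A viewed as a vector in ℝⁿ, and let a'_i denote the i-th column of Â^{-1}. Then for all i, j ≤ n, w(a_i, P) · (a_{n+1} · a'_i) = w(a_j, P) · (a_{n+1} · a'_j); equivalently, w(a_i, P)/w(a_j, P) = (a_{n+1} · a'_j)/(a_{n+1} · a'_i). -/
open Matrix

/-- A nonempty bounded polyhedron `{x | Ax ≤ b}` has trivial recession cone. -/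
theorem eq_zero_of_mulVec_nonpos_of_isBounded {m n : ℕ} {A : Matrix (Fin m) (Fin n) ℝ}
    {b : Fin m → ℝ} (hbd : Bornology.IsBounded {x | A *ᵥ x ≤ b})
    (hne : {x | A *ᵥ x ≤ b}.Nonempty) {d : Fin n → ℝ} (hd : A *ᵥ d ≤ 0) : d = 0 := by
  obtain ⟨x, hx⟩ := hne
  obtain ⟨C, hC⟩ := hbd.exists_norm_le
  by_contra h
  have hd0 : 0 < ‖d‖ := norm_pos_iff.mpr h
  have hC0 : 0 ≤ C := (norm_nonneg x).trans (hC x hx)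
  have ht : 0 ≤ (C + ‖x‖ + 1) / ‖d‖ := by positivity
  have hmem : x + ((C + ‖x‖ + 1) / ‖d‖) • d ∈ {x | A *ᵥ x ≤ b} := by
    intro k
    have h1 := hx k
    have h2 := mul_nonpos_of_nonneg_of_nonpos ht (hd k)
    simp only [mulVec_add, mulVec_smul, Pi.add_apply, Pi.smul_apply, smul_eq_mul]
    linarith
  have h1 := hC _ hmem
  have h2 : ‖((C + ‖x‖ + 1) / ‖d‖) • d‖ = C + ‖x‖ + 1 := by
    rw [norm_smul, Real.norm_of_nonneg ht, div_mul_cancel₀ _ hd0.ne']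
  have h3 := norm_sub_le (x + ((C + ‖x‖ + 1) / ‖d‖) • d) x
  rw [add_sub_cancel_left, h2] at h3
  linarith

/-- If the first `n` rows of `A` form an invertible matrix `B` and the last row is a negative
combination `c` of them, the image of `{x | Ax ≤ b}` under a row of `B` is an interval. -/
theorem image_dotProduct_row_eq_Icc {n : ℕ} {A : Matrix (Fin (n + 1)) (Fin n) ℝ}
    {b : Fin (n + 1) → ℝ} {B : Matrix (Fin n) (Fin n) ℝ} (hB : B = A.submatrix Fin.castSucc id)
    (hdet : IsUnit B.det) {c : Fin n → ℝ} (hc : c = A (Fin.last n) ᵥ* B⁻¹)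
    (hneg : ∀ k, c k < 0) (i : Fin n) :
    (fun x => A i.castSucc ⬝ᵥ x) '' {x | A *ᵥ x ≤ b} =
      Set.Icc (b i.castSucc + (b (Fin.last n) - c ⬝ᵥ fun k => b k.castSucc) / c i)
        (b i.castSucc) := by
  have hrow (x : Fin n → ℝ) (k : Fin n) : A k.castSucc ⬝ᵥ x = (B *ᵥ x) k := by
    rw [hB]; rfl
  have hlast (x : Fin n → ℝ) : A (Fin.last n) ⬝ᵥ x = c ⬝ᵥ (B *ᵥ x) := by
    rw [hc, dotProduct_mulVec, vecMul_vecMul, nonsing_inv_mul _ hdet, vecMul_one]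
  have hmem (x : Fin n → ℝ) : A *ᵥ x ≤ b ↔
      (∀ k : Fin n, (B *ᵥ x) k ≤ b k.castSucc) ∧ c ⬝ᵥ (B *ᵥ x) ≤ b (Fin.last n) := by
    rw [Pi.le_def, Fin.forall_fin_succ', ← hlast]
    simp only [← hrow]
    rfl
  ext t
  simp only [Set.mem_image, Set.mem_ofPred_eq, Set.mem_Icc, hmem, hrow]
  constructor
  · rintro ⟨x, ⟨h1, h2⟩, rfl⟩
    refine ⟨?_, h1 i⟩
    have h3 : -c i * (b i.castSucc - (B *ᵥ x) i) ≤
        ∑ k, -c k * (b k.castSucc - (B *ᵥ x) k) :=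
      Finset.single_le_sum (f := fun k => -c k * (b k.castSucc - (B *ᵥ x) k))
        (fun k _ => mul_nonneg (neg_nonneg.mpr (hneg k).le) (sub_nonneg.mpr (h1 k)))
        (Finset.mem_univ i)
    have h4 : ∑ k, -c k * (b k.castSucc - (B *ᵥ x) k) =
        c ⬝ᵥ (B *ᵥ x) - c ⬝ᵥ fun k => b k.castSucc := by
      simp only [dotProduct, ← Finset.sum_sub_distrib]
      exact Finset.sum_congr rfl fun k _ => by ring
    rw [← le_sub_iff_add_le', div_le_iff_of_neg (hneg i)]
    linarith
  · rintro ⟨h1, h2⟩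
    have hy : B *ᵥ (B⁻¹ *ᵥ ((fun k => b k.castSucc) - Pi.single i (b i.castSucc - t))) =
        (fun k => b k.castSucc) - Pi.single i (b i.castSucc - t) := by
      rw [mulVec_mulVec, mul_nonsing_inv _ hdet, one_mulVec]
    refine ⟨B⁻¹ *ᵥ ((fun k => b k.castSucc) - Pi.single i (b i.castSucc - t)), ?_, ?_⟩
    · rw [hy]
      constructor
      · intro k
        rw [Pi.sub_apply, sub_le_self_iff]
        have h3 : (0 : Fin n → ℝ) ≤ Pi.single i (b i.castSucc - t) :=
          Pi.single_nonneg.mpr (sub_nonneg.mpr h2)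
        exact h3 k
      · rw [← le_sub_iff_add_le', div_le_iff_of_neg (hneg i)] at h1
        rw [dotProduct_sub, dotProduct_single]
        linarith
    · simp [hy]

/-- Let `P = {x ∈ ℝⁿ : Ax ≤ b}` be a full-dimensional simplex with `A ∈ ℝ^{(n+1)×n}`, let
`Â` be the (invertible) matrix formed by the first `n` rows of `A`, `a_i` the `i`-th row of
`A`, and `a'_i` the `i`-th column of `Â⁻¹`.  Then for all `i, j ≤ n`,
`w(a_i, P) · (a_{n+1} · a'_i) = w(a_j, P) · (a_{n+1} · a'_j)`, i.e.
`w(a_i, P)/w(a_j, P) = (a_{n+1} · a'_j)/(a_{n+1} · a'_i)`. -/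
theorem facet_width_ratio {n : ℕ}
    (A : Matrix (Fin (n + 1)) (Fin n) ℝ) (b : Fin (n + 1) → ℝ)
    (P : Set (Fin n → ℝ)) (hP : P = {x | A.mulVec x ≤ b})
    (hbd : Bornology.IsBounded P) (hint : (interior P).Nonempty)
    (Ahat : Matrix (Fin n) (Fin n) ℝ) (hAhat : Ahat = A.submatrix Fin.castSucc id)
    (i j : Fin n) :
    width (A i.castSucc) P * (A (Fin.last n) ⬝ᵥ fun k => Ahat⁻¹ k i)
      = width (A j.castSucc) P * (A (Fin.last n) ⬝ᵥ fun k => Ahat⁻¹ k j) := by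
  subst hP
  have hne := hint.mono interior_subset
  have hrow (x : Fin n → ℝ) (k : Fin n) : (A *ᵥ x) k.castSucc = (Ahat *ᵥ x) k := by
    rw [hAhat]; rfl
  have hdet : IsUnit Ahat.det := by
    rw [isUnit_iff_ne_zero]
    intro h0
    obtain ⟨v, hv0, hv⟩ := exists_mulVec_eq_zero_iff.mpr h0
    rcases le_total ((A *ᵥ v) (Fin.last n)) 0 with h | h
    · refine hv0 (eq_zero_of_mulVec_nonpos_of_isBounded hbd hne ?_)
      rw [Pi.le_def, Fin.forall_fin_succ']
      exact ⟨fun k => by simp [hrow, hv], h⟩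
    · refine hv0 (neg_eq_zero.mp (eq_zero_of_mulVec_nonpos_of_isBounded hbd hne ?_))
      rw [Pi.le_def, Fin.forall_fin_succ']
      exact ⟨fun k => by simp [hrow, hv, mulVec_neg], by simpa [mulVec_neg] using h⟩
  set c := A (Fin.last n) ᵥ* Ahat⁻¹ with hc
  have hneg (k : Fin n) : c k < 0 := by
    by_contra! hk
    have hy : Ahat *ᵥ (Ahat⁻¹ *ᵥ -Pi.single k 1) = -Pi.single k 1 := by
      rw [mulVec_mulVec, mul_nonsing_inv _ hdet, one_mulVec]
    have h0 : Ahat⁻¹ *ᵥ -Pi.single k 1 = 0 := by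
      refine eq_zero_of_mulVec_nonpos_of_isBounded hbd hne ?_
      rw [Pi.le_def, Fin.forall_fin_succ']
      constructor
      · intro l
        rw [hrow, hy, Pi.neg_apply, Pi.zero_apply, neg_nonpos]
        have h3 : (0 : Fin n → ℝ) ≤ Pi.single k 1 := Pi.single_nonneg.mpr zero_le_one
        exact h3 l
      · change A (Fin.last n) ⬝ᵥ _ ≤ 0
        rw [dotProduct_mulVec, ← hc, dotProduct_neg, dotProduct_single_one]
        exact neg_nonpos.mpr hk
    rw [h0, mulVec_zero] at hy
    simpa using congrFun hy k
  have key (k : Fin n) : width (A k.castSucc) {x | A *ᵥ x ≤ b} * c k =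
      (c ⬝ᵥ fun l => b l.castSucc) - b (Fin.last n) := by
    have himg := image_dotProduct_row_eq_Icc (b := b) hAhat hdet hc hneg k
    have hle := Set.nonempty_Icc.mp (himg ▸ hne.image _)
    rw [width, himg, csSup_Icc hle, csInf_Icc hle]
    have := (hneg k).ne
    field_simp
    ring
  exact (key i).trans (key j).symm
end

section
/- There exists a function g : ℕ → ℕ with the following property: for every n ≥ 1 and every Δ ∈ ℕ, if A ∈ ℤ^{(n+1)×n} is a matrix whose first n rows form a lower-triangular matrix in Hermite Normal Form (lower triangular, positive diagonal entries, and each off-diagonal entry h_{ij} with j < i satisfying 0 ≤ h_{ij} < h_{ii}), Δ_A ≤ Δ, and {x ∈ ℝⁿ : Ax ≤ b} is a full-dimensional simplex for some b ∈ ℝ^{n+1}, then every entry of A has absolute value at most g(Δ). -/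
open Matrix

theorem one_add_sum_sub_one_le_prod {ι : Type*} (s : Finset ι) (d : ι → ℤ)
    (hd : ∀ i ∈ s, 1 ≤ d i) : 1 + ∑ i ∈ s, (d i - 1) ≤ ∏ i ∈ s, d i := by
  classical
  induction s using Finset.induction_on with
  | empty => simp
  | insert a s ha ih =>
    rw [Finset.sum_insert ha, Finset.prod_insert ha]
    have h1 := hd a (Finset.mem_insert_self a s)
    have h2 := ih fun i hi => hd i (Finset.mem_insert_of_mem hi)
    have h3 : 0 ≤ ∑ i ∈ s, (d i - 1) :=
      Finset.sum_nonneg fun i hi => by linarith [hd i (Finset.mem_insert_of_mem hi)]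
    nlinarith

section HermiteNormalForm

variable {n : ℕ} {H : Matrix (Fin n) (Fin n) ℤ}

theorem det_eq_prod_diag_of_lower (hlow : ∀ i j, i < j → H i j = 0) :
    H.det = ∏ i, H i i :=
  Matrix.det_of_isLowerTriangular H fun i j hij => hlow i j hij

theorem hnf_entry_nonneg (hlow : ∀ i j, i < j → H i j = 0) (hpos : ∀ i, 0 < H i i)
    (hred : ∀ i j, j < i → 0 ≤ H i j ∧ H i j < H i i) (i j : Fin n) : 0 ≤ H i j := by
  rcases lt_trichotomy i j with h | rfl | h
  · exact (hlow i j h).ge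
  · exact (hpos i).le
  · exact (hred i j h).1

/-- The column sums of a matrix in Hermite Normal Form are at most its determinant. -/
theorem hnf_column_sum_le_det (hlow : ∀ i j, i < j → H i j = 0) (hpos : ∀ i, 0 < H i i)
    (hred : ∀ i j, j < i → 0 ≤ H i j ∧ H i j < H i i) (j : Fin n) :
    ∑ i, H i j ≤ H.det := by
  rw [det_eq_prod_diag_of_lower hlow]
  refine le_trans ?_ (one_add_sum_sub_one_le_prod Finset.univ _ fun i _ => hpos i)
  rw [← Finset.add_sum_erase _ _ (Finset.mem_univ j),
    ← Finset.add_sum_erase _ (fun i => H i i - 1) (Finset.mem_univ j)]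
  have : ∑ i ∈ Finset.univ.erase j, H i j ≤ ∑ i ∈ Finset.univ.erase j, (H i i - 1) := by
    refine Finset.sum_le_sum fun i hi => ?_
    rcases lt_or_gt_of_ne (Finset.ne_of_mem_erase hi) with h | h
    · rw [hlow i j h]
      linarith [hpos i]
    · linarith [(hred i j h).2]
  linarith

end HermiteNormalForm

/-- Cramer's rule for the row vector `a`. -/
theorem det_mul_eq_sum_det_updateRow {m R : Type*} [Fintype m] [DecidableEq m] [CommRing R]
    (H : Matrix m m R) (a : m → R) (j : m) :
    H.det * a j = ∑ i, (H.updateRow i a).det * H i j := by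
  have h := congrFun (Matrix.mulVec_cramer Hᵀ a) j
  simp only [Matrix.mulVec, dotProduct, Matrix.transpose_apply, Matrix.cramer_transpose_apply,
    Matrix.det_transpose, Pi.smul_apply, smul_eq_mul] at h
  rw [← h]
  exact Finset.sum_congr rfl fun i _ => mul_comm _ _

/-- The selection of rows `0, …, n` in which row `i` is replaced by the last one. -/
def replaceByLast {n : ℕ} (i : Fin n) : Fin n ↪ Fin (n + 1) where
  toFun := Function.update Fin.castSucc i (Fin.last n)
  inj' := by
    intro k l hkl
    have hne (m : Fin n) := (Fin.castSucc_lt_last m).ne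
    by_cases hk : k = i <;> by_cases hl : l = i <;>
      simp_all [Function.update_apply, eq_comm]

theorem submatrix_replaceByLast {n : ℕ} {R : Type*} (A : Matrix (Fin (n + 1)) (Fin n) R)
    (i : Fin n) : A.submatrix (replaceByLast i) id =
      (A.submatrix Fin.castSucc id).updateRow i (A (Fin.last n)) := by
  ext k l
  change A (Function.update Fin.castSucc i (Fin.last n) k) l = _
  by_cases hk : k = i
  · subst hk
    simp
  · simp [hk]

/-- There is a function `g : ℕ → ℕ` such that for every `n ≥ 1`, every `Δ ∈ ℕ`, and every
matrix `A ∈ ℤ^{(n+1)×n}` whose first `n` rows form a lower-triangular matrix in Hermite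
Normal Form, with all `n × n` subdeterminants of `A` bounded in absolute value by `Δ`, if
`{x ∈ ℝⁿ : Ax ≤ b}` is a full-dimensional simplex (bounded with nonempty interior) for some
`b ∈ ℝ^{n+1}`, then every entry of `A` has absolute value at most `g(Δ)`. -/
theorem entries_bounded_of_hnf_simplex :
    ∃ g : ℕ → ℕ, ∀ n : ℕ, 1 ≤ n → ∀ Δ : ℕ,
      ∀ A : Matrix (Fin (n + 1)) (Fin n) ℤ,
        -- the first `n` rows of `A` are lower triangular
        (∀ i j : Fin n, i < j → A i.castSucc j = 0) →
        -- with positive diagonal entries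
        (∀ i : Fin n, 0 < A i.castSucc i) →
        -- and off-diagonal entries reduced modulo the diagonal (Hermite Normal Form)
        (∀ i j : Fin n, j < i → 0 ≤ A i.castSucc j ∧ A i.castSucc j < A i.castSucc i) →
        -- `Δ_A ≤ Δ`
        (∀ g' : Fin n ↪ Fin (n + 1), ((A.submatrix g' id).det).natAbs ≤ Δ) →
        -- `{x : Ax ≤ b}` is a full-dimensional simplex for some `b`
        (∃ b : Fin (n + 1) → ℝ,
          Bornology.IsBounded {x : Fin n → ℝ | (A.map (Int.cast : ℤ → ℝ)).mulVec x ≤ b} ∧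
          (interior {x : Fin n → ℝ | (A.map (Int.cast : ℤ → ℝ)).mulVec x ≤ b}).Nonempty) →
        ∀ i j, (A i j).natAbs ≤ g Δ := by
  refine ⟨id, fun n _ Δ A hlow hpos hred hdet _ i j => ?_⟩
  let H : Matrix (Fin n) (Fin n) ℤ := A.submatrix Fin.castSucc id
  have hnonneg : ∀ i j, 0 ≤ H i j := hnf_entry_nonneg hlow hpos hred
  have hcol : ∀ j, ∑ i, H i j ≤ H.det := hnf_column_sum_le_det hlow hpos hred
  have hdetpos : 0 < H.det := by
    rw [det_eq_prod_diag_of_lower (H := H) hlow]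
    exact Finset.prod_pos fun i _ => hpos i
  have hdetle : H.det ≤ Δ := by
    have h : H.det.natAbs ≤ Δ := hdet Fin.castSuccEmb
    lia
  suffices h : |A i j| ≤ Δ by
    rwa [Int.abs_eq_natAbs, Nat.cast_le] at h
  induction i using Fin.lastCases with
  | cast i =>
    have hle : H i j ≤ ∑ k, H k j :=
      Finset.single_le_sum (f := fun k => H k j) (fun k _ => hnonneg k j) (Finset.mem_univ i)
    exact (abs_of_nonneg (hnonneg i j)).trans_le (hle.trans ((hcol j).trans hdetle))
  | last =>
    refine le_of_mul_le_mul_left ?_ hdetpos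
    calc H.det * |A (Fin.last n) j|
        = |∑ i, (H.updateRow i (A (Fin.last n))).det * H i j| := by
          rw [← det_mul_eq_sum_det_updateRow, abs_mul, abs_of_pos hdetpos]
      _ ≤ ∑ i, |(H.updateRow i (A (Fin.last n))).det * H i j| := Finset.abs_sum_le_sum_abs _ _
      _ ≤ ∑ i, Δ * H i j := by
          refine Finset.sum_le_sum fun i _ => ?_
          rw [abs_mul, abs_of_nonneg (hnonneg i j)]
          refine mul_le_mul_of_nonneg_right ?_ (hnonneg i j)
          have h := hdet (replaceByLast i)
          rw [submatrix_replaceByLast] at h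
          change (H.updateRow i (A (Fin.last n))).det.natAbs ≤ Δ at h
          rwa [Int.abs_eq_natAbs, Nat.cast_le]
      _ = Δ * ∑ i, H i j := (Finset.mul_sum _ _ _).symm
      _ ≤ Δ * H.det := mul_le_mul_of_nonneg_left (hcol j) (Int.natCast_nonneg Δ)
      _ = H.det * Δ := mul_comm _ _
end

section
/- Let H ∈ ℤ^{n×n} be a lower-triangular matrix in Hermite Normal Form (positive diagonal entries h_{ii}, and each off-diagonal entry h_{ij} with j < i satisfying 0 ≤ h_{ij} < h_{ii}) with 1 < det(H) ≤ Δ. Let q be such that h_{ii} = 1 for i ≤ n − q and h_{ii} > 1 for i > n − q. Then every column of H^{-1} has at most q + 1 nonzero entries. -/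
open Matrix Finset

/-- If row `i` of an invertible matrix is the `i`-th row of the identity, then so is row `i` of
its inverse. -/
theorem Matrix.inv_apply_eq_one_apply_of_row_eq_one {m R : Type*} [Fintype m] [DecidableEq m]
    [CommRing R] {A : Matrix m m R} (hA : IsUnit A.det) {i : m}
    (hi : ∀ k, A i k = (1 : Matrix m m R) i k) (j : m) :
    A⁻¹ i j = (1 : Matrix m m R) i j := by
  rw [← A.mul_nonsing_inv hA, Matrix.mul_apply]
  simp [hi, Matrix.one_apply]

/-- Let `H ∈ ℤ^{n×n}` be lower triangular in Hermite Normal Form with `1 < det H ≤ Δ`, with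
`H i i = 1` for `i ≤ n − q` and `H i i > 1` for `i > n − q`, where `q` is the number of
diagonal entries greater than `1`.  Then every column of `H⁻¹` has at most `q + 1` nonzero
entries. -/
theorem inverse_columns_sparse {n : ℕ} (Δ : ℕ)
    (H : Matrix (Fin n) (Fin n) ℤ)
    (hlt : ∀ i j : Fin n, i < j → H i j = 0)
    (hdiag : ∀ i : Fin n, 0 < H i i)
    (hhnf : ∀ i j : Fin n, j < i → 0 ≤ H i j ∧ H i j < H i i)
    (hdet1 : 1 < H.det) (hdet2 : H.det ≤ (Δ : ℤ))
    (q : ℕ) (hq : q = (Finset.univ.filter fun i : Fin n => 1 < H i i).card)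
    (h1 : ∀ i : Fin n, (i : ℕ) < n - q → H i i = 1)
    (h2 : ∀ i : Fin n, n - q ≤ (i : ℕ) → 1 < H i i) :
    ∀ j : Fin n,
      {i : Fin n | (H.map (Int.cast : ℤ → ℝ))⁻¹ i j ≠ 0}.ncard ≤ q + 1 := by
  intro j
  set A := H.map (Int.cast : ℤ → ℝ) with hA
  have hunit : IsUnit A.det := by
    have hcast : A.det = (H.det : ℝ) := (Int.cast_det H).symm
    rw [hcast, isUnit_iff_ne_zero]
    exact_mod_cast (zero_lt_one.trans hdet1).ne'
  have hrow : ∀ i, H i i = 1 → ∀ k, A i k = (1 : Matrix (Fin n) (Fin n) ℝ) i k := by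
    intro i hi k
    rcases lt_trichotomy i k with h | rfl | h
    · simp [hA, hlt i k h, Matrix.one_apply_ne h.ne]
    · simp [hA, hi]
    · have hzero : H i k = 0 := by have := hhnf i k h; lia
      simp [hA, hzero, Matrix.one_apply_ne h.ne']
  have hsub : {i : Fin n | A⁻¹ i j ≠ 0} ⊆
      ↑(insert j (Finset.univ.filter fun i : Fin n => 1 < H i i)) := by
    intro i hij
    simp only [Finset.coe_insert, Set.mem_insert_iff, Finset.mem_coe, Finset.mem_filter,
      Finset.mem_univ, true_and]
    by_contra! hcon
    have hi : H i i = 1 := le_antisymm hcon.2 (hdiag i)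
    apply hij
    rw [Matrix.inv_apply_eq_one_apply_of_row_eq_one hunit (hrow i hi),
      Matrix.one_apply_ne hcon.1]
  calc {i : Fin n | A⁻¹ i j ≠ 0}.ncard
      ≤ (insert j (Finset.univ.filter fun i : Fin n => 1 < H i i)).card :=
        (Set.ncard_le_ncard hsub (Finset.finite_toSet _)).trans_eq (Set.ncard_coe_finset _)
    _ ≤ q + 1 := hq ▸ Finset.card_insert_le _ _
end

section
/- Let H ∈ ℤ^{n×n} be a lower-triangular matrix in Hermite Normal Form (positive diagonal entries h_{ii}, and each off-diagonal entry h_{ij} with j < i satisfying 0 ≤ h_{ij} < h_{ii}) with 1 < det(H) ≤ Δ, and suppose h_{ii} = 1 for i ≤ n − q and h_{ii} > 1 for i > n − q, where q is the number of diagonal entries strictly greater than 1. Then every entry h'_{ij} of H^{-1} satisfies |h'_{ij}| ≤ Δ^{log₂(Δ) − 1} · (⌈log₂(Δ)⌉)!. -/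
open Matrix Finset

/-- In a Hermite normal form, a row with diagonal entry `1` is a row of the identity matrix, and
hence so is the corresponding row of the inverse. -/
theorem hnf_right_inverse_row_of_diag_eq_one {n : ℕ} {H : Matrix (Fin n) (Fin n) ℤ}
    (hlt : ∀ i j : Fin n, i < j → H i j = 0)
    (hhnf : ∀ i j : Fin n, j < i → 0 ≤ H i j ∧ H i j < H i i)
    {G : Matrix (Fin n) (Fin n) ℝ} (hG : H.map (Int.cast : ℤ → ℝ) * G = 1)
    {i : Fin n} (hi : H i i = 1) (j : Fin n) : G i j = (1 : Matrix (Fin n) (Fin n) ℝ) i j := by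
  rw [← hG, Matrix.mul_apply, Finset.sum_eq_single i]
  · simp [hi]
  · intro k _ hk
    have : H i k = 0 := by
      rcases lt_or_gt_of_ne hk with h | h
      · have := hhnf i k h
        lia
      · exact hlt i k h
    simp [this]
  · simp

/-- A bound on the entries of one row of the inverse of a Hermite normal form in terms of the
previous rows. -/
theorem abs_hnf_right_inverse_apply_le {n : ℕ} {H : Matrix (Fin n) (Fin n) ℤ}
    (hlt : ∀ i j : Fin n, i < j → H i j = 0)
    (hdiag : ∀ i : Fin n, 0 < H i i)
    (hhnf : ∀ i j : Fin n, j < i → 0 ≤ H i j ∧ H i j < H i i)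
    {G : Matrix (Fin n) (Fin n) ℝ} (hG : H.map (Int.cast : ℤ → ℝ) * G = 1)
    (i j : Fin n) {B : ℝ} (hB : 1 ≤ B) (hS : ∑ k with k < i, |G k j| ≤ B) : |G i j| ≤ B := by
  have hrow : ∑ k, (H i k : ℝ) * G k j = (1 : Matrix (Fin n) (Fin n) ℝ) i j := by
    rw [← hG, Matrix.mul_apply]
    rfl
  have hsplit : ∑ k, (H i k : ℝ) * G k j
      = (H i i : ℝ) * G i j + ∑ k with k < i, (H i k : ℝ) * G k j := by
    rw [← Finset.add_sum_erase _ _ (Finset.mem_univ i)]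
    congr 1
    symm
    apply Finset.sum_subset
    · intro k hk
      simpa using (Finset.mem_filter.1 hk).2.ne
    · intro k hk hk'
      have hki : i < k := by
        simp only [Finset.mem_erase, Finset.mem_filter, Finset.mem_univ, true_and, and_true,
          not_lt] at hk hk'
        exact lt_of_le_of_ne hk' (Ne.symm hk)
      simp [hlt i k hki]
  have hd : (1 : ℝ) ≤ H i i := by exact_mod_cast hdiag i
  have hsum : |∑ k with k < i, (H i k : ℝ) * G k j| ≤ ((H i i : ℝ) - 1) * B := by
    calc |∑ k with k < i, (H i k : ℝ) * G k j|
        ≤ ∑ k with k < i, |(H i k : ℝ) * G k j| := Finset.abs_sum_le_sum_abs _ _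
      _ ≤ ∑ k with k < i, ((H i i : ℝ) - 1) * |G k j| := by
          refine Finset.sum_le_sum fun k hk => ?_
          obtain ⟨h0, hlt'⟩ := hhnf i k (Finset.mem_filter.1 hk).2
          have h0' : (0 : ℝ) ≤ H i k := by exact_mod_cast h0
          have hle : (H i k : ℝ) ≤ H i i - 1 := by exact_mod_cast Int.le_sub_one_of_lt hlt'
          rw [abs_mul, abs_of_nonneg h0']
          gcongr
      _ = ((H i i : ℝ) - 1) * ∑ k with k < i, |G k j| := (Finset.mul_sum _ _ _).symm
      _ ≤ ((H i i : ℝ) - 1) * B := by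
          have := sub_nonneg.2 hd
          gcongr
  have hone : |(1 : Matrix (Fin n) (Fin n) ℝ) i j| ≤ 1 := by
    rw [Matrix.one_apply]
    split_ifs <;> simp
  have hmul : (H i i : ℝ) * |G i j| ≤ H i i * B := by
    have heq : (H i i : ℝ) * G i j = (1 : Matrix (Fin n) (Fin n) ℝ) i j
        - ∑ k with k < i, (H i k : ℝ) * G k j := by
      linarith
    calc (H i i : ℝ) * |G i j| = |(H i i : ℝ) * G i j| := by
          rw [abs_mul, abs_of_nonneg (by linarith : (0 : ℝ) ≤ H i i)]
      _ ≤ |(1 : Matrix (Fin n) (Fin n) ℝ) i j| + |∑ k with k < i, (H i k : ℝ) * G k j| := by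
          rw [heq]
          exact abs_sub _ _
      _ ≤ H i i * B := by linarith
  exact le_of_mul_le_mul_left hmul (by linarith)

/-- If the first `m` diagonal entries of a Hermite normal form are `1`, then the absolute values in
the first `t` rows of a column of the inverse sum to at most `2 ^ (t - m)`. -/
theorem sum_abs_hnf_right_inverse_le {n m : ℕ} {H : Matrix (Fin n) (Fin n) ℤ}
    (hlt : ∀ i j : Fin n, i < j → H i j = 0)
    (hdiag : ∀ i : Fin n, 0 < H i i)
    (hhnf : ∀ i j : Fin n, j < i → 0 ≤ H i j ∧ H i j < H i i)
    {G : Matrix (Fin n) (Fin n) ℝ} (hG : H.map (Int.cast : ℤ → ℝ) * G = 1)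
    (hone : ∀ i : Fin n, (i : ℕ) < m → H i i = 1) (j : Fin n) {t : ℕ} (ht : t ≤ n) :
    ∑ k with Fin.val k < t, |G k j| ≤ (2 : ℝ) ^ (t - m) := by
  induction t with
  | zero => simp
  | succ t ih =>
    rcases lt_or_ge t m with htm | htm
    · rw [Nat.sub_eq_zero_of_le htm, pow_zero]
      calc ∑ k with Fin.val k < t + 1, |G k j|
          = ∑ k with Fin.val k < t + 1, |(1 : Matrix (Fin n) (Fin n) ℝ) k j| := by
            refine Finset.sum_congr rfl fun k hk => ?_
            have hk' := (Finset.mem_filter.1 hk).2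
            rw [hnf_right_inverse_row_of_diag_eq_one hlt hhnf hG (hone k (by lia))]
        _ ≤ ∑ k : Fin n, |(1 : Matrix (Fin n) (Fin n) ℝ) k j| :=
            Finset.sum_le_sum_of_subset_of_nonneg (Finset.filter_subset _ _)
              fun _ _ _ => abs_nonneg _
        _ = 1 := by
            rw [Finset.sum_eq_single j]
            · simp
            · intro k _ hk
              simp [Matrix.one_apply_ne hk]
            · simp
    · have hS := ih (by lia)
      have hentry : |G ⟨t, ht⟩ j| ≤ (2 : ℝ) ^ (t - m) :=
        abs_hnf_right_inverse_apply_le hlt hdiag hhnf hG _ j (one_le_pow₀ one_le_two) hS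
      have hinsert : (Finset.univ.filter fun k : Fin n => (k : ℕ) < t + 1)
          = insert ⟨t, ht⟩ (Finset.univ.filter fun k : Fin n => (k : ℕ) < t) := by
        ext k
        simp only [Finset.mem_filter, Finset.mem_univ, true_and, Finset.mem_insert, Fin.ext_iff]
        lia
      rw [hinsert, Finset.sum_insert (by simp), Nat.sub_add_comm htm, pow_succ]
      linarith

/-- The product of positive integers is at least `2` to the number of factors exceeding `1`. -/
theorem two_pow_card_one_lt_le_prod {ι : Type*} [Fintype ι] {d : ι → ℤ} (hd : ∀ i, 0 < d i) :
    (2 : ℤ) ^ (Finset.univ.filter fun i => 1 < d i).card ≤ ∏ i, d i := by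
  rw [← Finset.prod_const, Finset.prod_filter]
  refine Finset.prod_le_prod (fun i _ => by split_ifs <;> norm_num) fun i _ => ?_
  have := hd i
  split_ifs <;> lia

theorem half_le_rpow_logb_mul_factorial {x : ℝ} (hx : 2 ≤ x) :
    x / 2 ≤ x ^ (Real.logb 2 x - 1) * ((Nat.ceil (Real.logb 2 x)).factorial : ℝ) := by
  have hlog : 1 ≤ Real.logb 2 x := by
    rw [Real.le_logb_iff_rpow_le one_lt_two (by linarith)]
    simpa using hx
  have hfact : (1 : ℝ) ≤ (Nat.ceil (Real.logb 2 x)).factorial := by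
    exact_mod_cast Nat.factorial_pos _
  have hpow : 1 ≤ x ^ (Real.logb 2 x - 1) := Real.one_le_rpow (by linarith) (by linarith)
  rcases hx.eq_or_lt with rfl | hx2
  · calc (2 : ℝ) / 2 = 1 * 1 := by norm_num
      _ ≤ _ := by gcongr
  rcases lt_or_ge x 4 with hx4 | hx4
  · have hlog' : 1 < Real.logb 2 x := by
      rw [Real.lt_logb_iff_rpow_lt one_lt_two (by linarith)]
      simpa using hx2
    have hceil : 2 ≤ Nat.ceil (Real.logb 2 x) := Nat.lt_ceil.2 (by simpa using hlog')
    have hfact2 : (2 : ℝ) ≤ (Nat.ceil (Real.logb 2 x)).factorial := by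
      exact_mod_cast hceil.trans (Nat.self_le_factorial _)
    calc x / 2 ≤ 1 * 2 := by linarith
      _ ≤ _ := by gcongr
  · have hlog' : 2 ≤ Real.logb 2 x := by
      rw [Real.le_logb_iff_rpow_le one_lt_two (by linarith)]
      norm_num
      exact hx4
    have hpow' : x ≤ x ^ (Real.logb 2 x - 1) :=
      Real.self_le_rpow_of_one_le (by linarith) (by linarith)
    calc x / 2 ≤ x * 1 := by linarith
      _ ≤ _ := by gcongr

/-- Let `H ∈ ℤ^{n×n}` be lower triangular in Hermite Normal Form with `1 < det H ≤ Δ`, with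
`H i i = 1` for `i ≤ n − q` and `H i i > 1` for `i > n − q`, where `q` is the number of
diagonal entries greater than `1`.  Then every entry `h'_{ij}` of `H⁻¹` satisfies
`|h'_{ij}| ≤ Δ^{log₂ Δ − 1} · (⌈log₂ Δ⌉)!`. -/
theorem inverse_entries_bounded {n : ℕ} (Δ : ℕ)
    (H : Matrix (Fin n) (Fin n) ℤ)
    (hlt : ∀ i j : Fin n, i < j → H i j = 0)
    (hdiag : ∀ i : Fin n, 0 < H i i)
    (hhnf : ∀ i j : Fin n, j < i → 0 ≤ H i j ∧ H i j < H i i)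
    (hdet1 : 1 < H.det) (hdet2 : H.det ≤ (Δ : ℤ))
    (q : ℕ) (hq : q = (Finset.univ.filter fun i : Fin n => 1 < H i i).card)
    (h1 : ∀ i : Fin n, (i : ℕ) < n - q → H i i = 1)
    (h2 : ∀ i : Fin n, n - q ≤ (i : ℕ) → 1 < H i i) :
    ∀ i j : Fin n,
      |(H.map (Int.cast : ℤ → ℝ))⁻¹ i j|
        ≤ (Δ : ℝ) ^ (Real.logb 2 (Δ : ℝ) - 1)
            * ((Nat.ceil (Real.logb 2 (Δ : ℝ))).factorial : ℝ) := by
  intro i j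
  have hprod : H.det = ∏ i, H i i := Matrix.det_of_isLowerTriangular H fun i j hij => hlt i j hij
  have hG : H.map (Int.cast : ℤ → ℝ) * (H.map (Int.cast : ℤ → ℝ))⁻¹ = 1 := by
    refine Matrix.mul_nonsing_inv _ (isUnit_iff_ne_zero.2 ?_)
    have hcast : ((H.det : ℤ) : ℝ) = (H.map (Int.cast : ℤ → ℝ)).det := Int.cast_det H
    rw [← hcast]
    exact_mod_cast (zero_lt_one.trans hdet1).ne'
  have hentry : |(H.map (Int.cast : ℤ → ℝ))⁻¹ i j| ≤ (2 : ℝ) ^ ((i : ℕ) - (n - q)) :=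
    abs_hnf_right_inverse_apply_le hlt hdiag hhnf hG i j (one_le_pow₀ one_le_two)
      (sum_abs_hnf_right_inverse_le hlt hdiag hhnf hG h1 j i.isLt.le)
  have hq0 : q ≠ 0 := by
    rintro rfl
    have : H.det = 1 := by
      rw [hprod]
      exact Finset.prod_eq_one fun k _ => h1 k (by simp)
    lia
  have hqΔ : (2 : ℝ) ^ q ≤ Δ := by
    have := ((two_pow_card_one_lt_le_prod hdiag).trans_eq hprod.symm).trans hdet2
    rw [← hq] at this
    exact_mod_cast this
  have hΔ : (2 : ℝ) ≤ Δ := by exact_mod_cast hdet1.trans_le hdet2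
  have hi : (i : ℕ) - (n - q) ≤ q - 1 := by
    have := i.isLt
    lia
  calc |(H.map (Int.cast : ℤ → ℝ))⁻¹ i j| ≤ (2 : ℝ) ^ ((i : ℕ) - (n - q)) := hentry
    _ ≤ (2 : ℝ) ^ (q - 1) := pow_le_pow_right₀ one_le_two hi
    _ = (2 : ℝ) ^ q / 2 := by
        rw [← pow_sub_one_mul hq0, mul_div_cancel_right₀ _ two_ne_zero]
    _ ≤ (Δ : ℝ) / 2 := by gcongr
    _ ≤ _ := half_le_rpow_logb_mul_factorial hΔ
end

section
/- Let A ∈ ℤ^{n×n} be invertible with |det(A)| = Δ, let b ∈ ℤⁿ, and let C = {x ∈ ℝⁿ : Ax ≤ b}. Let a'_1, …, a'_n be the columns of A^{-1}, let u := A^{-1}b, and let X be the convex hull of C ∩ ℤⁿ. If v is a vertex (extreme point) of X, written as v = u − Σ_{i=1}^n μ_i a'_i where μ_i = b_i − (Av)_i ≥ 0, then Π_{i=1}^n (μ_i + 1) ≤ Δ. -/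
open Matrix

theorem card_quotient_range_mulVecLin {n : ℕ} (A : Matrix (Fin n) (Fin n) ℤ) (hA : A.det ≠ 0) :
    Nat.card ((Fin n → ℤ) ⧸ LinearMap.range A.mulVecLin) = A.det.natAbs := by
  have hinj : Function.Injective A.mulVecLin := by
    rw [injective_iff_map_eq_zero]
    intro x hx
    exact Matrix.eq_zero_of_mulVec_eq_zero hA hx
  rw [← Submodule.natAbs_det_equiv _ (LinearEquiv.ofInjective A.mulVecLin hinj),
    ← LinearMap.det_toLin' A]
  rfl

/-- Pigeonhole modulo the lattice `A ℤⁿ`: a box with more than `|det A|` integer points contains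
two that differ by a nonzero element of the lattice. -/
theorem exists_ne_zero_abs_mulVec_le {n : ℕ} (A : Matrix (Fin n) (Fin n) ℤ) (hA : A.det ≠ 0)
    (μ : Fin n → ℤ) (hμ0 : ∀ i, 0 ≤ μ i) (h : |A.det| < ∏ i, (μ i + 1)) :
    ∃ z : Fin n → ℤ, z ≠ 0 ∧ ∀ i, |A.mulVec z i| ≤ μ i := by
  classical
  have hcard := card_quotient_range_mulVecLin A hA
  have : Finite ((Fin n → ℤ) ⧸ LinearMap.range A.mulVecLin) :=
    Nat.finite_of_card_ne_zero (by rw [hcard]; exact Int.natAbs_ne_zero.mpr hA)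
  have := Fintype.ofFinite ((Fin n → ℤ) ⧸ LinearMap.range A.mulVecLin)
  have hbox : ((Finset.Icc 0 μ).card : ℤ) = ∏ i, (μ i + 1) := by
    rw [Pi.card_Icc]
    push_cast
    refine Finset.prod_congr rfl fun i _ => ?_
    have := hμ0 i
    simp only [Int.card_Icc, Pi.zero_apply]
    omega
  have hlt : (Finset.univ : Finset ((Fin n → ℤ) ⧸ LinearMap.range A.mulVecLin)).card <
      (Finset.Icc 0 μ).card := by
    rw [Finset.card_univ, ← Nat.card_eq_fintype_card, hcard]
    zify
    rwa [hbox]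
  obtain ⟨x, hx, y, hy, hxy, he⟩ := Finset.exists_ne_map_eq_of_card_lt_of_maps_to hlt
    (f := (LinearMap.range A.mulVecLin).mkQ) (by simp)
  obtain ⟨z, hz⟩ := (Submodule.Quotient.eq _).mp he
  rw [mulVecLin_apply] at hz
  rw [Finset.mem_Icc] at hx hy
  refine ⟨z, ?_, fun i => ?_⟩
  · rintro rfl
    rw [mulVec_zero] at hz
    exact hxy (sub_eq_zero.mp hz.symm)
  · have h1 := hx.1 i
    have h2 := hx.2 i
    have h3 := hy.1 i
    have h4 := hy.2 i
    simp only [Pi.zero_apply] at h1 h3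
    rw [hz, Pi.sub_apply, abs_le]
    constructor <;> linarith

/-- Let `A ∈ ℤ^{n×n}` be invertible with `|det A| = Δ`, `b ∈ ℤⁿ`, `C = {x ∈ ℝⁿ : Ax ≤ b}`,
and `X` the convex hull of `C ∩ ℤⁿ`.  If `v` is a vertex of `X` (a point of `X` not in the
convex hull of `X \ {v}`), written `v = u − Σᵢ μᵢ a'ᵢ` with `μᵢ = bᵢ − (Av)ᵢ ≥ 0`, then
`Πᵢ (μᵢ + 1) ≤ Δ`. -/
theorem vertex_multiplier_product_bound {n : ℕ}
    (A : Matrix (Fin n) (Fin n) ℤ) (hA : A.det ≠ 0) (b : Fin n → ℤ)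
    (Δ : ℕ) (hΔ : (Δ : ℤ) = |A.det|)
    (C : Set (Fin n → ℝ))
    (hC : C = {x | (A.map (Int.cast : ℤ → ℝ)).mulVec x ≤ fun i => (b i : ℝ)})
    (X : Set (Fin n → ℝ)) (hX : X = convexHull ℝ (C ∩ intPts n))
    (v : Fin n → ℤ)
    (μ : Fin n → ℤ) (hμ : ∀ i, μ i = b i - A.mulVec v i) (hμ0 : ∀ i, 0 ≤ μ i)
    (hvX : (fun k => (v k : ℝ)) ∈ X)
    (hvert : (fun k => (v k : ℝ)) ∉ convexHull ℝ (X \ {fun k => (v k : ℝ)})) :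
    ∏ i, (μ i + 1) ≤ (Δ : ℤ) := by
  by_contra! hlt
  rw [hΔ] at hlt
  obtain ⟨z, hz0, hz⟩ := exists_ne_zero_abs_mulVec_le A hA μ hμ0 hlt
  have mem (w : Fin n → ℤ) (hw0 : w ≠ 0) (hw : ∀ i, A.mulVec w i ≤ μ i) :
      (fun k => ((v + w) k : ℝ)) ∈ X \ {fun k => (v k : ℝ)} := by
    subst hX hC
    refine ⟨subset_convexHull ℝ _ ⟨fun i => ?_, fun i => ⟨_, rfl⟩⟩, fun h => hw0 ?_⟩
    · have hi : A.mulVec (v + w) i ≤ b i := by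
        rw [mulVec_add, Pi.add_apply]
        linarith [hμ i, hw i]
      have : (A.map (Int.cast : ℤ → ℝ)).mulVec (fun k => ((v + w) k : ℝ)) i
          = (A.mulVec (v + w) i : ℝ) :=
        (RingHom.map_mulVec (Int.castRingHom ℝ) A (v + w) i).symm
      rw [this]
      exact Int.cast_le.mpr hi
    · ext k
      have := congrFun h k
      simpa using this
  have h1 := mem z hz0 fun i => (abs_le.mp (hz i)).2
  have h2 := mem (-z) (neg_ne_zero.mpr hz0) fun i => by
    rw [mulVec_neg, Pi.neg_apply]
    linarith [(abs_le.mp (hz i)).1]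
  apply hvert
  convert! (convex_convexHull ℝ _).midpoint_mem (subset_convexHull ℝ _ h1)
    (subset_convexHull ℝ _ h2) using 1
  ext k
  simp [midpoint_eq_smul_add]
  ring
end

section
/- Let A ∈ ℤ^{n×n} be invertible with |det(A)| = Δ, let b ∈ ℤⁿ, and let C = {x ∈ ℝⁿ : Ax ≤ b}. Let a'_1, …, a'_n be the columns of A^{-1}, let u := A^{-1}b, and let X be the convex hull of C ∩ ℤⁿ. Let S be the simplex given by the convex hull of the n+1 points {u, u − (Δ−1)a'_1, u − (Δ−1)a'_2, …, u − (Δ−1)a'_n}. Then every vertex (extreme point) of X lies in S. -/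
open Matrix

/-- The cokernel of a nonsingular integer matrix has `|det A|` elements. -/
theorem Matrix.natCard_quotient_range_toLin' {ι : Type*} [Fintype ι] [DecidableEq ι]
    (A : Matrix ι ι ℤ) (hA : A.det ≠ 0) :
    Nat.card ((ι → ℤ) ⧸ LinearMap.range A.toLin') = A.det.natAbs := by
  have hinj : Function.Injective A.toLin' := by
    rw [injective_iff_map_eq_zero]
    exact fun x hx => eq_zero_of_mulVec_eq_zero hA hx
  rw [← Submodule.natAbs_det_equiv _ (LinearEquiv.ofInjective A.toLin' hinj), ← LinearMap.det_toLin']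
  rfl

/-- A family of at least `|M ⧸ N|` elements of `M`, given by multiplicities `s`, has a nonempty
subfamily whose sum lies in `N`. -/
theorem Submodule.exists_sub_multiplicity_sum_mem {R M ι : Type*} [Ring R] [AddCommGroup M]
    [Module R M] [Fintype ι] (N : Submodule R M) [Finite (M ⧸ N)] (g : ι → M) (s : ι → ℕ)
    (hs : Nat.card (M ⧸ N) ≤ ∑ i, s i) :
    ∃ t : ι → ℕ, t ≠ 0 ∧ t ≤ s ∧ ∑ i, t i • g i ∈ N := by
  classical
  set l : List ι := (∑ i, s i • ({i} : Multiset ι)).toList with hl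
  have hcount (i : ι) : l.count i = s i := by
    rw [← Multiset.coe_count, hl, Multiset.coe_toList]
    simp [Multiset.count_sum', Multiset.count_singleton]
  have hlen : l.length = ∑ i, s i := by
    rw [hl, Multiset.length_toList]
    simp
  have hsum (m : List ι) : ∑ i, m.count i • g i = (m.map g).sum :=
    (Finset.sum_list_map_count m g).symm ▸ (Finset.sum_subset (Finset.subset_univ _)
      fun i _ hi => by simp [List.count_eq_zero_of_not_mem (by simpa using hi)]).symm
  obtain ⟨j, k, hjk, h⟩ : ∃ j k : Fin (l.length + 1), j < k ∧
      N.mkQ ((l.take j).map g).sum = N.mkQ ((l.take k).map g).sum := by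
    have := Fintype.ofFinite (M ⧸ N)
    obtain ⟨j, k, hne, h⟩ := Fintype.exists_ne_map_eq_of_card_lt
      (fun j : Fin (l.length + 1) => N.mkQ ((l.take j).map g).sum)
      (by rw [Fintype.card_fin, ← Nat.card_eq_fintype_card]; omega)
    rcases lt_or_gt_of_ne hne with hlt | hlt
    exacts [⟨j, k, hlt, h⟩, ⟨k, j, hlt, h.symm⟩]
  set m := (l.take k).drop j with hm
  have hsplit : l.take k = l.take j ++ m := by
    rw [hm, ← min_eq_left (show (j : ℕ) ≤ k from hjk.le), ← List.take_take,
      min_eq_left (show (j : ℕ) ≤ k from hjk.le), List.take_append_drop]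
  have hsub : m.Sublist l := (List.drop_sublist _ _).trans (List.take_sublist _ _)
  refine ⟨fun i => m.count i, fun h0 => ?_, fun i => hcount i ▸ hsub.count_le i, ?_⟩
  · have hnil : m = [] := List.eq_nil_iff_forall_not_mem.2 fun i =>
      List.count_eq_zero.1 (congrFun h0 i)
    have := congrArg List.length hnil
    simp only [hm, List.length_drop, List.length_take, List.length_nil] at this
    omega
  · rw [hsum, ← Submodule.Quotient.mk_eq_zero, ← Submodule.mkQ_apply]
    simpa [hsplit] using h

/-- A point `u - ∑ i, w i • a i` with `w ≥ 0` and `∑ i, w i ≤ c` lies in the simplex with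
vertices `u` and `u - c • a i`. -/
theorem sub_sum_smul_mem_convexHull {E ι : Type*} [AddCommGroup E] [Module ℝ E] [Fintype ι]
    (u : E) (a : ι → E) (w : ι → ℝ) (hw : ∀ i, 0 ≤ w i) {c : ℝ} (hc : ∑ i, w i ≤ c) :
    u - ∑ i, w i • a i ∈ convexHull ℝ ({u} ∪ Set.range fun i => u - c • a i) := by
  have hu : u ∈ convexHull ℝ ({u} ∪ Set.range fun i => u - c • a i) :=
    subset_convexHull ℝ _ (Or.inl rfl)
  rcases (Finset.sum_nonneg fun i _ => hw i).trans hc |>.eq_or_lt with h0 | hpos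
  · have hw0 : ∀ i, w i = 0 := fun i => (Finset.sum_eq_zero_iff_of_nonneg fun i _ => hw i).1
      (le_antisymm (hc.trans h0.ge) (Finset.sum_nonneg fun i _ => hw i)) i (Finset.mem_univ i)
    simpa [hw0] using hu
  · have key := (convex_convexHull ℝ ({u} ∪ Set.range fun i => u - c • a i)).sum_mem
      (t := Finset.univ) (w := fun o : Option ι => o.elim (1 - ∑ i, w i / c) fun i => w i / c)
      (z := fun o : Option ι => o.elim u fun i => u - c • a i) ?_ ?_ ?_
    · convert key using 1
      simp only [Fintype.sum_option, Option.elim_none, Option.elim_some, smul_sub,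
        Finset.sum_sub_distrib, ← Finset.sum_smul, smul_smul, div_mul_cancel₀ _ hpos.ne', sub_smul,
        one_smul]
      abel
    · rintro (_ | i) -
      · simpa [← Finset.sum_div] using (div_le_one hpos).2 hc
      · exact div_nonneg (hw i) hpos.le
    · simp [Fintype.sum_option]
    · rintro (_ | i) -
      · exact hu
      · exact subset_convexHull ℝ _ (Or.inr ⟨i, rfl⟩)

/-- A vertex of the convex hull of `P` belongs to `P`. -/
theorem mem_of_notMem_convexHull_diff_singleton {E : Type*} [AddCommGroup E] [Module ℝ E]
    {P : Set E} {v : E} (hv : v ∈ convexHull ℝ P)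
    (hvert : v ∉ convexHull ℝ (convexHull ℝ P \ {v})) : v ∈ P := by
  by_contra h
  have hP : P ⊆ convexHull ℝ P \ {v} := Set.subset_sdiff_singleton (subset_convexHull ℝ P) h
  exact hvert (convexHull_mono hP hv)

/-- A point is not a vertex of `X` if `X` contains a segment with this midpoint. -/
theorem mem_convexHull_diff_singleton_of_add_sub_mem {E : Type*} [AddCommGroup E] [Module ℝ E]
    {X : Set E} {v d : E} (hd : d ≠ 0) (hadd : v + d ∈ X) (hsub : v - d ∈ X) :
    v ∈ convexHull ℝ (X \ {v}) := by
  have key := (convex_convexHull ℝ (X \ {v})) (subset_convexHull ℝ _ ⟨hadd, by simpa using hd⟩)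
    (subset_convexHull ℝ _ ⟨hsub, by simpa using hd⟩)
    (by norm_num : (0 : ℝ) ≤ 1 / 2) (by norm_num : (0 : ℝ) ≤ 1 / 2) (by norm_num)
  convert key using 1
  module

/-- Let `A ∈ ℤ^{n×n}` be invertible with `|det A| = Δ`, `b ∈ ℤⁿ`, `C = {x ∈ ℝⁿ : Ax ≤ b}`,
`u = A⁻¹b`, `a'_1, …, a'_n` the columns of `A⁻¹`, and `X` the convex hull of `C ∩ ℤⁿ`.  Let
`S` be the simplex `conv{u, u − (Δ−1)a'_1, …, u − (Δ−1)a'_n}`.  Then every vertex of `X`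
(a point of `X` not in the convex hull of `X \ {v}`) lies in `S`. -/
theorem vertices_of_integer_hull_in_corner_simplex {n : ℕ}
    (A : Matrix (Fin n) (Fin n) ℤ) (hA : A.det ≠ 0) (b : Fin n → ℤ)
    (Δ : ℕ) (hΔ : (Δ : ℤ) = |A.det|)
    (C : Set (Fin n → ℝ))
    (hC : C = {x | (A.map (Int.cast : ℤ → ℝ)).mulVec x ≤ fun i => (b i : ℝ)})
    (u : Fin n → ℝ)
    (hu : u = (A.map (Int.cast : ℤ → ℝ))⁻¹.mulVec fun i => (b i : ℝ))
    (X : Set (Fin n → ℝ)) (hX : X = convexHull ℝ (C ∩ intPts n))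
    (S : Set (Fin n → ℝ))
    (hS : S = convexHull ℝ ({u} ∪ Set.range fun i : Fin n =>
        u - ((Δ : ℝ) - 1) • fun k => (A.map (Int.cast : ℤ → ℝ))⁻¹ k i))
    (v : Fin n → ℝ) (hvX : v ∈ X)
    (hvert : v ∉ convexHull ℝ (X \ {v})) :
    v ∈ S := by
  have hmap (z : Fin n → ℤ) : (A.map (Int.cast : ℤ → ℝ)).mulVec (fun i => (z i : ℝ)) =
      fun i => ((A.mulVec z i : ℤ) : ℝ) := by
    ext i
    simp [mulVec, dotProduct]
  have hdet : IsUnit (A.map (Int.cast : ℤ → ℝ)).det := by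
    have : (A.map (Int.cast : ℤ → ℝ)).det = (A.det : ℝ) := (Int.cast_det A).symm
    rw [this]
    exact (Int.cast_ne_zero.2 hA).isUnit
  subst hX
  obtain ⟨hvC, hvZ⟩ := mem_of_notMem_convexHull_diff_singleton hvX hvert
  choose z hz using hvZ
  obtain rfl : v = fun i => (z i : ℝ) := funext hz
  have hmem (y : Fin n → ℤ) (hy : A.mulVec y ≤ b) :
      (fun i => (y i : ℝ)) ∈ convexHull ℝ (C ∩ intPts n) := by
    refine subset_convexHull ℝ _ ⟨?_, fun i => ⟨y i, rfl⟩⟩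
    rw [hC, Set.mem_ofPred_eq, hmap]
    exact fun i => Int.cast_le.2 (hy i)
  rw [hC, Set.mem_ofPred_eq, hmap] at hvC
  obtain ⟨s, hs⟩ : ∃ s : Fin n → ℕ, ∀ i, A.mulVec z i + s i = b i :=
    ⟨fun i => (b i - A.mulVec z i).toNat, fun i => by
      have : A.mulVec z i ≤ b i := Int.cast_le.1 (hvC i)
      dsimp only
      omega⟩
  have hcard := A.natCard_quotient_range_toLin' hA
  have hlt : ∑ i, s i < Δ := by
    by_contra! hle
    have := Nat.finite_of_card_ne_zero (hcard ▸ Int.natAbs_ne_zero.2 hA)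
    obtain ⟨t, ht0, hts, y, hy⟩ := (LinearMap.range A.toLin').exists_sub_multiplicity_sum_mem
      (fun i => Pi.single i (1 : ℤ)) s
      (by rw [hcard]; rw [Int.abs_eq_natAbs] at hΔ; omega)
    have hAy (i : Fin n) : A.mulVec y i = t i := by
      rw [← toLin'_apply, hy]
      simp [Finset.sum_apply, Pi.single_apply]
    refine hvert (mem_convexHull_diff_singleton_of_add_sub_mem (d := fun i => (y i : ℝ)) ?_ ?_ ?_)
    · rintro h0
      obtain rfl : y = 0 := funext fun i => Int.cast_eq_zero.1 (congrFun h0 i)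
      exact ht0 (funext fun i => by simpa using (hAy i).symm)
    · convert hmem (z + y) fun i => ?_ using 1
      · ext i
        simp
      · have hsi := hs i
        have : (t i : ℤ) ≤ s i := Int.ofNat_le.2 (hts i)
        rw [mulVec_add, Pi.add_apply, hAy]
        linarith
    · convert hmem (z - y) fun i => ?_ using 1
      · ext i
        simp
      · have hsi := hs i
        rw [mulVec_sub, Pi.sub_apply, hAy]
        linarith
  have hv : (fun i => (z i : ℝ)) =
      u - ∑ i, (s i : ℝ) • fun k => (A.map (Int.cast : ℤ → ℝ))⁻¹ k i := by
    have hb : (fun i => (b i : ℝ)) =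
        (A.map (Int.cast : ℤ → ℝ)).mulVec (fun i => (z i : ℝ)) + fun i => (s i : ℝ) := by
      rw [hmap]
      ext i
      simp [← hs i]
    rw [hu, hb, mulVec_add, mulVec_mulVec, nonsing_inv_mul _ hdet, one_mulVec, eq_sub_iff_add_eq]
    congr 1
    ext k
    simp [mulVec, dotProduct, mul_comm]
  rw [hv, hS]
  refine sub_sum_smul_mem_convexHull u _ _ (fun i => Nat.cast_nonneg _) ?_
  rw [le_sub_iff_add_le]
  exact_mod_cast hlt
end
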